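/- Let G be a finitely generated abelian group, Φ₀: G → G a homomorphism satisfying a monic integer linear recurrence Φ₀^ℓ + c_{ℓ-1}Φ₀^{ℓ-1} + ... + c₀·id = 0, y, α ∈ G, Φ(x) = y + Φ₀(x), p a prime, k ∈ ℕ₀, and R₁, R₂ ∈ G. Let C = {R₁ + p^{nk}·R₂ : n ∈ ℕ₀}. Then S = {n ∈ ℕ₀ : Φ^n(α) ∈ C} is a finite union of p-arithmetic sequences together with a finite union of arithmetic progressions. -/

import Mathlib

/-- An arithmetic progression of natural numbers `{m·j + ℓ' : j ∈ ℕ₀}`. -/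
def IsAPNat (S : Set ℕ) : Prop :=
  ∃ m ℓ' : ℕ, S = {n : ℕ | ∃ j : ℕ, n = m * j + ℓ'}

/-- A `p`-arithmetic sequence of natural numbers: `{a·p^{k'n} + b : n ∈ ℕ₀} ∩ ℕ₀`. -/
def IsPArithSeqNat (p : ℕ) (S : Set ℕ) : Prop :=
  ∃ (a b : ℚ) (k' : ℕ), S = {n : ℕ | ∃ j : ℕ, (n : ℚ) = a * (p : ℚ) ^ (k' * j) + b}

namespace Stmt16Aux

section helpers

open Finset

theorem bc_prod (μ : ℝ) (m : ℕ) :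
    Ring.choose μ m = (∏ i ∈ range m, (μ - i)) / (m.factorial : ℝ) := by
  rw [Ring.choose_eq_smul]
  have : (descPochhammer ℤ m).smeval μ = ∏ i ∈ range m, (μ - i) := by
    rw [← descPochhammer_eval_eq_prod_range, ← Polynomial.aeval_eq_smeval,
      Polynomial.aeval_def, ← Polynomial.eval_map, descPochhammer_map]
  rw [this, smul_eq_mul, div_eq_inv_mul]

theorem bc_succ (μ : ℝ) (m : ℕ) :
    ((m : ℝ) + 1) * Ring.choose μ (m + 1) = μ * Ring.choose (μ - 1) m := by
  rw [bc_prod, bc_prod, prod_range_succ', Nat.factorial_succ]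
  have h1 : (m.factorial : ℝ) ≠ 0 := by exact_mod_cast Nat.factorial_ne_zero m
  have h2 : ((m : ℝ) + 1) ≠ 0 := by positivity
  have : ∏ i ∈ range m, (μ - ((i + 1 : ℕ) : ℝ)) = ∏ i ∈ range m, (μ - 1 - i) := by
    apply prod_congr rfl; intros; push_cast; ring
  rw [this]
  push_cast
  field_simp
  ring

theorem bc_vanish (r : ℕ) : ∀ (s k : ℕ) (μ ν : ℝ) (c : ℕ → ℝ), μ + ν = s → r ≤ s → s < k →
    ∑ m ∈ range (k + 1), Ring.choose μ m * Ring.choose ν (k - m) * ∏ i ∈ range r, (c i - m) = 0 := by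
  induction r with
  | zero =>
    intro s k μ ν c h hr hk
    have := Ring.add_choose_eq k (Commute.all μ ν)
    rw [h, Ring.choose_natCast, Nat.choose_eq_zero_of_lt hk,
      Finset.Nat.sum_antidiagonal_eq_sum_range_succ_mk] at this
    simpa using this.symm
  | succ r ih =>
    intro s k μ ν c h hr hk
    obtain ⟨k, rfl⟩ : ∃ k', k = k' + 1 := ⟨k - 1, by omega⟩
    obtain ⟨s, rfl⟩ : ∃ s', s = s' + 1 := ⟨s - 1, by omega⟩
    have h1 := ih (s + 1) (k + 1) μ ν c h (by omega) hk
    have h2 := ih s k (μ - 1) ν (fun i => c i - 1) (by push_cast at h; linarith) (by omega) (by omega)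
    have h3 : ∑ m ∈ range (k + 1 + 1), (m : ℝ) * (Ring.choose μ m * Ring.choose ν (k + 1 - m) *
        ∏ i ∈ range r, (c i - m)) = 0 := by
      rw [sum_range_succ']
      simp only [Nat.cast_zero, zero_mul, add_zero]
      rw [← mul_zero μ, ← h2, mul_sum]
      apply sum_congr rfl
      intro m _
      have h5 := bc_succ μ m
      have h6 : ∏ i ∈ range r, (c i - ((m + 1 : ℕ) : ℝ)) = ∏ i ∈ range r, (c i - 1 - m) := by
        apply prod_congr rfl; intros; push_cast; ring
      rw [h6, show k + 1 - (m + 1) = k - m by omega]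
      push_cast
      linear_combination (Ring.choose ν (k - m) * ∏ i ∈ range r, (c i - 1 - (m:ℝ))) * h5
    have h4 : ∀ m ∈ range (k + 1 + 1), Ring.choose μ m * Ring.choose ν (k + 1 - m) *
        ∏ i ∈ range (r + 1), (c i - m) = c r * (Ring.choose μ m * Ring.choose ν (k + 1 - m) *
        ∏ i ∈ range r, (c i - m)) - (m : ℝ) * (Ring.choose μ m * Ring.choose ν (k + 1 - m) *
        ∏ i ∈ range r, (c i - m)) := by
      intro m _
      rw [prod_range_succ]; ring
    rw [sum_congr rfl h4, sum_sub_distrib, h3, ← mul_sum, h1]; simp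

/-- Padé coefficients -/
noncomputable def pq (n m : ℕ) : ℝ := Ring.choose ((n : ℝ) - 1 / 5) m * ((2 * n - m).choose n : ℝ)

theorem pq_vanish (n k : ℕ) (h1 : n < k) (h2 : k ≤ 2 * n) :
    ∑ m ∈ range (k + 1), pq n m * Ring.choose (1 / 5 : ℝ) (k - m) = 0 := by
  have := bc_vanish n n k ((n : ℝ) - 1 / 5) (1 / 5) (fun i => 2 * n - i) (by ring) le_rfl h1
  have hn : (n.factorial : ℝ) ≠ 0 := by exact_mod_cast Nat.factorial_ne_zero n
  apply (mul_right_injective₀ hn)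
  simp only [mul_zero]
  rw [← this, mul_sum]
  apply sum_congr rfl
  intro m hm
  have hm' : m ≤ 2 * n := by simp at hm; omega
  have h3 : ∏ i ∈ range n, (2 * (n:ℝ) - i - m) = n.factorial * ((2 * n - m).choose n : ℝ) := by
    have := descPochhammer_eval_eq_descFactorial ℝ (2 * n - m) n
    rw [descPochhammer_eval_eq_prod_range, Nat.descFactorial_eq_factorial_mul_choose] at this
    push_cast [Nat.cast_sub hm'] at this
    rw [← this]
    apply prod_congr rfl; intros; ring
  rw [h3, pq]; ring

theorem bc_nonneg (n m : ℕ) (h : m ≤ n) : 0 ≤ Ring.choose ((n : ℝ) - 1 / 5) m := by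
  rw [bc_prod]
  apply div_nonneg _ (by positivity)
  apply prod_nonneg
  intro i hi
  have : (i : ℝ) + 1 ≤ n := by simp at hi; exact_mod_cast (by omega : i + 1 ≤ n)
  linarith

theorem bc_le (n m : ℕ) (h : m ≤ n) : Ring.choose ((n : ℝ) - 1 / 5) m ≤ n.choose m := by
  rw [← Ring.choose_natCast (R := ℝ), bc_prod, bc_prod]
  gcongr
  · intro i hi
    have : (i : ℝ) + 1 ≤ n := by simp at hi; exact_mod_cast (by omega : i + 1 ≤ n)
    linarith
  · linarith

theorem bc_fifth_abs (m : ℕ) : |Ring.choose (1 / 5 : ℝ) m| ≤ 1 := by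
  rw [bc_prod, abs_div, abs_prod, div_le_one (by positivity)]
  rw [Nat.abs_cast, ← prod_range_add_one_eq_factorial]
  push_cast
  apply prod_le_prod
  · intros; positivity
  · intro i _
    rw [abs_le]; constructor <;> linarith [(Nat.cast_nonneg i : (0:ℝ) ≤ i)]

theorem pq_zero (n m : ℕ) (h : n < m) (h2 : m ≤ 2 * n) : pq n m = 0 := by
  rw [pq, Nat.choose_eq_zero_of_lt (by omega)]; simp

theorem pq_nonneg (n m : ℕ) (h2 : m ≤ 2 * n) : 0 ≤ pq n m := by
  rcases le_or_gt m n with h | h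
  · exact mul_nonneg (bc_nonneg n m h) (by positivity)
  · rw [pq_zero n m h h2]

theorem pq_sum (n : ℕ) : ∑ m ∈ range (n + 1), pq n m ≤ 8 ^ n := by
  have : ∀ m ∈ range (n + 1), pq n m ≤ (n.choose m : ℝ) * 4 ^ n := by
    intro m hm
    simp at hm
    rw [pq]
    gcongr
    · exact bc_le n m (by omega)
    · have h1 : (2 * n - m).choose n ≤ (2 * n).choose n := Nat.choose_le_choose n (by omega)
      have h2 : (2 * n).choose n ≤ 2 ^ (2 * n) := Nat.choose_le_two_pow _ _
      rw [pow_mul] at h2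
      exact_mod_cast h1.trans h2
  refine (sum_le_sum this).trans ?_
  rw [← sum_mul]
  have := Nat.sum_range_choose n
  have h2 : ∑ i ∈ range (n + 1), (n.choose i : ℝ) = 2 ^ n := by exact_mod_cast this
  rw [h2, ← mul_pow]; norm_num

theorem fact_dvd (m : ℕ) (M : ℤ) :
    (m.factorial : ℤ) ∣ 5 ^ m * ∏ i ∈ range m, (M - 5 * i) := by
  have : Fact (Nat.Prime 5) := ⟨by norm_num⟩
  obtain ⟨u, hu⟩ := pow_padicValNat_dvd (p := 5) (n := m.factorial)
  set v := padicValNat 5 m.factorial with hv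
  have hvm : v ≤ m := by
    have := sub_one_mul_padicValNat_factorial (p := 5) m
    rw [← hv] at this
    omega
  have hcop : Nat.Coprime 5 u := by
    rw [Nat.Prime.coprime_iff_not_dvd (by norm_num)]
    rintro ⟨w, rfl⟩
    have : 5 ^ (v + 1) ∣ m.factorial := ⟨w, by rw [hu]; ring⟩
    rw [padicValNat_dvd_iff_le (Nat.factorial_ne_zero m)] at this
    omega
  rw [hu]
  push_cast
  apply mul_dvd_mul
  · exact pow_dvd_pow _ hvm
  · have h1 : (u : ℤ) ∣ m.factorial := by rw [hu]; push_cast; exact dvd_mul_left _ _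
    obtain ⟨s, t, hst⟩ := (Nat.isCoprime_iff_coprime.mpr hcop)
    -- s * 5 + t * u = 1
    have h2 : (m.factorial : ℤ) ∣ ∏ i ∈ range m, (M * s - i) := by
      refine ⟨Ring.choose (M * s) m, ?_⟩
      have := Ring.descPochhammer_eq_factorial_smul_choose (M * s) m
      rw [nsmul_eq_mul] at this
      rw [← this, ← descPochhammer_eval_eq_prod_range, ← Polynomial.aeval_eq_smeval,
        Polynomial.aeval_def, ← Polynomial.eval_map, descPochhammer_map]
    have h3 : (u : ℤ) ∣ 5 ^ m * ∏ i ∈ range m, (M * s - i) := (h1.trans h2).mul_left _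
    have h4 : ∏ i ∈ range m, (M - 5 * i) ≡ 5 ^ m * ∏ i ∈ range m, (M * s - i) [ZMOD u] := by
      have : (5:ℤ) ^ m = ∏ i ∈ range m, 5 := by simp
      rw [this, ← prod_mul_distrib]
      apply Int.ModEq.prod
      intro i _
      rw [Int.modEq_iff_dvd]
      refine ⟨-M * t, ?_⟩
      push_cast at hst
      linear_combination M * hst
    exact (Int.modEq_zero_iff_dvd.mp (h4.trans (Int.modEq_zero_iff_dvd.mpr h3)))

theorem bc_int (M : ℤ) (m : ℕ) : ∃ z : ℤ, (25 : ℝ) ^ m * Ring.choose ((M : ℝ) / 5) m = z := by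
  obtain ⟨z, hz⟩ := fact_dvd m M
  refine ⟨z, ?_⟩
  rw [bc_prod]
  have h1 : (m.factorial : ℝ) ≠ 0 := by exact_mod_cast Nat.factorial_ne_zero m
  rw [← mul_div_assoc, div_eq_iff h1]
  have : (25:ℝ) ^ m * ∏ i ∈ range m, ((M:ℝ) / 5 - i) = 5 ^ m * ∏ i ∈ range m, ((M:ℝ) - 5 * i) := by
    have e : (25:ℝ) ^ m = 5 ^ m * ∏ i ∈ range m, 5 := by simp [← mul_pow]; norm_num
    rw [e, mul_assoc, ← prod_mul_distrib]
    congr 1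
    apply prod_congr rfl; intros; ring
  rw [this, mul_comm (z : ℝ)]
  exact_mod_cast hz

theorem fifth_tail (z : ℝ) (h0 : 0 < z) (h1 : z ≤ 1 / 2) (K : ℕ) :
    |(1 + z) ^ (1 / 5 : ℝ) - ∑ k ∈ range K, Ring.choose (1 / 5 : ℝ) k * z ^ k| ≤ 2 * z ^ K := by
  have hs : HasSum (fun k => Ring.choose (1 / 5 : ℝ) k * z ^ k) ((1 + z) ^ (1 / 5 : ℝ)) := by
    have := (Real.one_add_rpow_hasFPowerSeriesOnBall_zero (a := 1 / 5)).hasSum (y := z)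
      (by simp
          rw [enorm_eq_nnnorm]; norm_cast
          rw [← NNReal.coe_lt_coe]; simp [abs_of_pos h0]; linarith)
    rw [zero_add] at this
    simp only [binomialSeries_apply] at this
    simpa using this
  have hs2 := (hasSum_nat_add_iff' K).mpr hs
  have hg : HasSum (fun k : ℕ => z ^ K * z ^ k) (z ^ K * (1 - z)⁻¹) :=
    (hasSum_geometric_of_lt_one h0.le (by linarith)).mul_left _
  have := hs2.norm_le_of_bounded hg (fun k => by
    rw [Real.norm_eq_abs, abs_mul, abs_of_pos (pow_pos h0 _), ← pow_add, add_comm K k]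
    have := bc_fifth_abs (k + K)
    have h3 := pow_pos h0 (k + K)
    nlinarith)
  rw [Real.norm_eq_abs] at this
  refine this.trans ?_
  have : (1 - z)⁻¹ ≤ 2 := by
    rw [inv_le_comm₀ (by linarith) (by norm_num)]; linarith
  have h3 := pow_pos h0 K
  nlinarith

theorem pade (n : ℕ) (D B : ℕ) (hD : 0 < D) (hB : 0 < B) (hBD : 2 * B ≤ D) :
    ∃ P Q : ℤ, ((25 : ℝ) * D) ^ n ≤ Q ∧ (Q : ℝ) ≤ (200 * D) ^ n ∧
      |(1 + (B : ℝ) / D) ^ (1 / 5 : ℝ) * Q - P| ≤ 2 * (200 * D) ^ n * ((B : ℝ) / D) ^ (2 * n + 1) := by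
  set z : ℝ := (B : ℝ) / D with hz
  have hD' : (0 : ℝ) < D := by exact_mod_cast hD
  have hB' : (0 : ℝ) < B := by exact_mod_cast hB
  have hz0 : 0 < z := by positivity
  have hz1 : z ≤ 1 / 2 := by
    rw [hz, div_le_iff₀ hD']
    have : (2 : ℝ) * B ≤ D := by exact_mod_cast hBD
    linarith
  set ω : ℝ := (1 + z) ^ (1 / 5 : ℝ)
  -- integrality
  have hint1 : ∀ m, ∃ w : ℤ, (25 : ℝ) ^ m * pq n m = w := by
    intro m
    obtain ⟨w, hw⟩ := bc_int (5 * n - 1) m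
    refine ⟨w * ((2 * n - m).choose n : ℤ), ?_⟩
    push_cast at hw ⊢
    rw [← hw, pq, show ((5 * (n : ℝ) - 1) / 5) = n - 1 / 5 by ring]
    ring
  have hint2 : ∀ m, ∃ w : ℤ, (25 : ℝ) ^ m * Ring.choose (1 / 5 : ℝ) m = w := by
    intro m
    obtain ⟨w, hw⟩ := bc_int 1 m
    exact ⟨w, by simpa using hw⟩
  have key : ∀ c : ℕ → ℝ, (∀ m, ∃ w : ℤ, (25 : ℝ) ^ m * c m = w) →
      ∃ W : ℤ, (25 * (D : ℝ)) ^ n * ∑ k ∈ range (n + 1), c k * z ^ k = W := by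
    intro c hc
    choose w hw using hc
    refine ⟨∑ k ∈ range (n + 1), (25 * (D : ℤ)) ^ (n - k) * (w k * B ^ k), ?_⟩
    push_cast
    rw [mul_sum]
    apply sum_congr rfl
    intro k hk
    simp at hk
    rw [← hw, ← Nat.sub_add_cancel (show k ≤ n by omega), pow_add, hz, div_pow]
    simp only [Nat.add_sub_cancel, mul_pow]
    field_simp
  let pc : ℕ → ℝ := fun k => ∑ m ∈ range (k + 1), pq n m * Ring.choose (1 / 5 : ℝ) (k - m)
  have hpc : ∀ k, ∃ w : ℤ, (25 : ℝ) ^ k * pc k = w := by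
    intro k
    choose w1 hw1 using hint1
    choose w2 hw2 using hint2
    refine ⟨∑ m ∈ range (k + 1), w1 m * w2 (k - m), ?_⟩
    push_cast
    simp only [pc]
    rw [mul_sum]
    apply sum_congr rfl
    intro m hm
    simp at hm
    rw [← hw1, ← hw2]
    have : (25 : ℝ) ^ k = 25 ^ m * 25 ^ (k - m) := by rw [← pow_add]; congr 1; omega
    rw [this]; ring
  obtain ⟨Q, hQ⟩ := key (pq n) hint1
  obtain ⟨P, hP⟩ := key pc hpc
  set q := ∑ k ∈ range (n + 1), pq n k * z ^ k with hq
  have hq1 : 1 ≤ q := by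
    have h1 : ∀ k ∈ range (n + 1), 0 ≤ pq n k * z ^ k := by
      intro k hk; simp at hk
      exact mul_nonneg (pq_nonneg _ _ (by omega)) (by positivity)
    have := single_le_sum h1 (show 0 ∈ range (n + 1) by simp)
    refine le_trans ?_ this
    simp [pq]
    exact_mod_cast Nat.one_le_iff_ne_zero.mpr (Nat.choose_pos (by omega)).ne'
  have hq2 : q ≤ 8 ^ n := by
    refine le_trans (sum_le_sum ?_) (pq_sum n)
    intro k hk; simp at hk
    exact mul_le_of_le_one_right (pq_nonneg _ _ (by omega)) (pow_le_one₀ hz0.le (by linarith))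
  have hrem : |ω * q - ∑ k ∈ range (n + 1), pc k * z ^ k| ≤ 2 * 8 ^ n * z ^ (2 * n + 1) := by
    have e1 : ∑ k ∈ range (n + 1), pc k * z ^ k = ∑ k ∈ range (2 * n + 1), pc k * z ^ k := by
      apply sum_subset
      · intro k hk; simp at hk ⊢; omega
      · intro k hk hk2
        simp at hk hk2
        simp only [pc]
        rw [pq_vanish n k (by omega) (by omega), zero_mul]
    have e2 : ∑ k ∈ range (2 * n + 1), pc k * z ^ k =
        ∑ m ∈ range (2 * n + 1), pq n m * z ^ m *
          ∑ l ∈ range (2 * n + 1 - m), Ring.choose (1 / 5 : ℝ) l * z ^ l := by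
      have := sum_range_diag_flip (2 * n + 1)
        (fun m l => pq n m * z ^ m * (Ring.choose (1 / 5 : ℝ) l * z ^ l))
      simp only [mul_sum]
      rw [← this]
      apply sum_congr rfl
      intro k hk
      simp only [pc, sum_mul]
      apply sum_congr rfl
      intro m hm
      simp at hm
      have : z ^ k = z ^ m * z ^ (k - m) := by rw [← pow_add]; congr 1; omega
      rw [this]; ring
    have e3 : ∑ m ∈ range (2 * n + 1), pq n m * z ^ m *
          ∑ l ∈ range (2 * n + 1 - m), Ring.choose (1 / 5 : ℝ) l * z ^ l =
        ∑ m ∈ range (n + 1), pq n m * z ^ m *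
          ∑ l ∈ range (2 * n + 1 - m), Ring.choose (1 / 5 : ℝ) l * z ^ l := by
      symm
      apply sum_subset
      · intro k hk; simp at hk ⊢; omega
      · intro k hk hk2
        simp at hk hk2
        rw [pq_zero n k (by omega) (by omega)]; simp
    rw [e1, e2, e3, hq, mul_sum, ← sum_sub_distrib]
    refine (abs_sum_le_sum_abs _ _).trans ?_
    have : ∀ m ∈ range (n + 1), |ω * (pq n m * z ^ m) - pq n m * z ^ m *
          ∑ l ∈ range (2 * n + 1 - m), Ring.choose (1 / 5 : ℝ) l * z ^ l| ≤
          pq n m * (2 * z ^ (2 * n + 1)) := by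
      intro m hm
      simp at hm
      have h1 := fifth_tail z hz0 hz1 (2 * n + 1 - m)
      have h2 := pq_nonneg n m (by omega)
      have h3 : z ^ (2 * n + 1) = z ^ m * z ^ (2 * n + 1 - m) := by
        rw [← pow_add]; congr 1; omega
      have h4 : 0 ≤ pq n m * z ^ m := by positivity
      rw [show ω * (pq n m * z ^ m) - pq n m * z ^ m *
          ∑ l ∈ range (2 * n + 1 - m), Ring.choose (1 / 5 : ℝ) l * z ^ l = (pq n m * z ^ m) *
          (ω - ∑ l ∈ range (2 * n + 1 - m), Ring.choose (1 / 5 : ℝ) l * z ^ l) by ring,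
        abs_mul, abs_of_nonneg h4, h3]
      calc _ ≤ (pq n m * z ^ m) * (2 * z ^ (2 * n + 1 - m)) := by gcongr
        _ = _ := by ring
    refine (sum_le_sum this).trans ?_
    rw [← sum_mul]
    have h5 := pq_sum n
    have : 0 < z ^ (2 * n + 1) := by positivity
    nlinarith
  have hpos : 0 < (25 * (D : ℝ)) ^ n := by positivity
  have h200 : (200 * (D : ℝ)) ^ n = (25 * D) ^ n * 8 ^ n := by rw [← mul_pow]; ring
  refine ⟨P, Q, ?_, ?_, ?_⟩
  · rw [← hQ]; nlinarith
  · rw [← hQ, h200]; gcongr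
  · rw [← hQ, ← hP, show ω * ((25 * (D : ℝ)) ^ n * q) - (25 * D) ^ n * ∑ k ∈ range (n + 1), pc k * z ^ k
      = (25 * (D : ℝ)) ^ n * (ω * q - ∑ k ∈ range (n + 1), pc k * z ^ k) by ring, abs_mul,
      abs_of_pos hpos, h200]
    calc _ ≤ (25 * (D : ℝ)) ^ n * (2 * 8 ^ n * z ^ (2 * n + 1)) := by gcongr
      _ = _ := by ring

theorem thue_arith (B E y0 y n : ℕ) (hB : 0 < B) (hE1 : 8 * B ^ 2 ≤ E)
    (hy0 : E ^ 2 ≤ y0) (hn1 : y ^ 3 ≤ y0 ^ (5 * n)) (hn2 : y0 ^ (5 * n) ≤ y ^ 3 * y0 ^ 5)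
    (hy : (16 * B ^ 2) ^ 5 * y0 ^ 65 < y) :
    124 * (8 * B ^ 2) ^ n * y ^ 5 < y0 ^ (10 * n + 5) ∧
    4 * B * y0 * (E * y0 ^ 5) ^ n < y ^ 4 := by
  have hE8 : 8 ≤ E := le_trans (by nlinarith [pow_pos hB 2]) hE1
  have hy3 : 3 ≤ y0 := le_trans (by nlinarith) hy0
  have hypos : 0 < y := by omega
  have hEn : (E ^ n) ^ 2 ≤ y0 ^ n := by
    rw [← pow_mul, mul_comm, pow_mul]; exact Nat.pow_le_pow_left hy0 n
  constructor
  · have h8 : (8 * B ^ 2) ^ n ≤ E ^ n := Nat.pow_le_pow_left hE1 n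
    refine lt_of_le_of_lt (b := 124 * E ^ n * y ^ 5) (by gcongr) ?_
    apply lt_of_pow_lt_pow_left₀ 6 (by positivity)
    calc (124 * E ^ n * y ^ 5) ^ 6 = 124 ^ 6 * ((E ^ n) ^ 2) ^ 3 * (y ^ 3) ^ 10 := by ring
      _ ≤ 124 ^ 6 * (y0 ^ n) ^ 3 * (y0 ^ (5 * n)) ^ 10 := by gcongr
      _ < (y0 ^ 5) ^ 6 * (y0 ^ n) ^ 3 * (y0 ^ (5 * n)) ^ 10 := by
          have : 124 < y0 ^ 5 := lt_of_lt_of_le (by norm_num) (Nat.pow_le_pow_left hy3 5)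
          gcongr
      _ = y0 ^ (53 * n + 30) := by ring
      _ ≤ y0 ^ (60 * n + 30) := Nat.pow_le_pow_right (by omega) (by omega)
      _ = (y0 ^ (10 * n + 5)) ^ 6 := by ring
  · apply lt_of_pow_lt_pow_left₀ 10 (by positivity)
    calc (4 * B * y0 * (E * y0 ^ 5) ^ n) ^ 10 
        = (16 * B ^ 2) ^ 5 * y0 ^ 10 * ((E ^ n) ^ 2) ^ 5 * (y0 ^ (5 * n)) ^ 10 := by
          rw [mul_pow E]; ring
      _ ≤ (16 * B ^ 2) ^ 5 * y0 ^ 10 * (y0 ^ n) ^ 5 * (y0 ^ (5 * n)) ^ 10 := by gcongr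
      _ = (16 * B ^ 2) ^ 5 * y0 ^ 10 * (y0 ^ (5 * n)) ^ 11 := by ring
      _ ≤ (16 * B ^ 2) ^ 5 * y0 ^ 10 * (y ^ 3 * y0 ^ 5) ^ 11 := by gcongr
      _ = ((16 * B ^ 2) ^ 5 * y0 ^ 65) * y ^ 33 := by ring
      _ < y * y ^ 33 := by gcongr
      _ = y ^ 34 := by ring
      _ ≤ y ^ 40 := Nat.pow_le_pow_right hypos (by omega)
      _ = (y ^ 4) ^ 10 := by ring

set_option maxHeartbeats 2000000 in
theorem thue_core (a b B E x0 y0 x y : ℕ) (ha : 0 < a) (hb : 0 < b) (hB : 0 < B)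
    (h0 : a * x0 ^ 5 = b * y0 ^ 5 + B) (h : a * x ^ 5 = b * y ^ 5 + B)
    (hE1 : 8 * B ^ 2 ≤ E) (hE2 : 200 * b ≤ E) (hy0 : E ^ 2 ≤ y0)
    (hy : (16 * B ^ 2) ^ 5 * y0 ^ 65 < y) : False := by
  have hE8 : 8 ≤ E := le_trans (by nlinarith [pow_pos hB 2]) hE1
  have hy3 : 3 ≤ y0 := le_trans (by nlinarith) hy0
  have hBE : 2 * B ≤ E := by nlinarith
  have hypos : 0 < y := by omega
  -- choose n
  have hex : ∃ n, y ^ 3 ≤ y0 ^ (5 * n) := by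
    refine ⟨y ^ 3, ?_⟩
    calc y ^ 3 ≤ 5 * y ^ 3 := by omega
      _ ≤ y0 ^ (5 * y ^ 3) := (Nat.lt_pow_self (by omega)).le
  obtain ⟨n, hn1, hn2⟩ : ∃ n, y ^ 3 ≤ y0 ^ (5 * n) ∧ y0 ^ (5 * n) ≤ y ^ 3 * y0 ^ 5 := by
    classical
    refine ⟨Nat.find hex, Nat.find_spec hex, ?_⟩
    rcases Nat.eq_zero_or_pos (Nat.find hex) with h | h
    · rw [h, mul_zero, pow_zero]; exact Nat.one_le_iff_ne_zero.mpr (by positivity)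
    · have := Nat.find_min hex (Nat.sub_lt h one_pos)
      push Not at this
      calc y0 ^ (5 * Nat.find hex) = y0 ^ (5 * (Nat.find hex - 1)) * y0 ^ 5 := by
            rw [← pow_add]; congr 1; omega
        _ ≤ _ := by gcongr
  obtain ⟨c1, c2⟩ := thue_arith B E y0 y n hB hE1 hy0 hn1 hn2 hy
  obtain ⟨P, Q, hQ1, hQ2, hPQ⟩ := pade n (b * y0 ^ 5) B (by positivity) hB (by
    calc 2 * B ≤ E := hBE
      _ ≤ E ^ 2 := by nlinarith
      _ ≤ y0 := hy0
      _ ≤ y0 ^ 5 := Nat.le_self_pow (by norm_num) _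
      _ ≤ b * y0 ^ 5 := Nat.le_mul_of_pos_left _ hb)
  have ha' : (0 : ℝ) < a := by exact_mod_cast ha
  have hb' : (1 : ℝ) ≤ b := by exact_mod_cast hb
  have hB' : (1 : ℝ) ≤ B := by exact_mod_cast hB
  have hy0' : (3 : ℝ) ≤ y0 := by exact_mod_cast hy3
  have hy' : (1 : ℝ) ≤ y := by exact_mod_cast hypos
  have h0' : (a : ℝ) * x0 ^ 5 = b * y0 ^ 5 + B := by exact_mod_cast h0
  have h' : (a : ℝ) * x ^ 5 = b * y ^ 5 + B := by exact_mod_cast h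
  push_cast at hQ1 hQ2 hPQ
  set D : ℝ := (b : ℝ) * y0 ^ 5 with hD
  have hDpos : 0 < D := by positivity
  set z : ℝ := B / D with hz
  have hzpos : 0 < z := by positivity
  set ω : ℝ := (1 + z) ^ (1 / 5 : ℝ) with hω
  set θ : ℝ := ((a : ℝ) / b) ^ (1 / 5 : ℝ) with hθ
  have hθpos : 0 < θ := by positivity
  have hθ5 : θ ^ 5 = a / b := by
    rw [hθ, ← Real.rpow_natCast, ← Real.rpow_mul (by positivity)]; norm_num
  have hω5 : ω ^ 5 = 1 + z := by
    rw [hω, ← Real.rpow_natCast, ← Real.rpow_mul (by positivity)]; norm_num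
  have hωpos : 0 < ω := by positivity
  have hω1 : 1 ≤ ω := by
    by_contra hc
    push Not at hc
    have := pow_lt_one₀ hωpos.le hc (n := 5) (by norm_num)
    linarith
  have hz1 : z ≤ 1 := by
    rw [hz, div_le_one hDpos, hD]
    have : (B : ℝ) ≤ b * y0 ^ 5 := by
      have : B ≤ b * y0 ^ 5 := by
        calc B ≤ E := by omega
          _ ≤ E ^ 2 := by nlinarith
          _ ≤ y0 := hy0
          _ ≤ y0 ^ 5 := Nat.le_self_pow (by norm_num) _
          _ ≤ b * y0 ^ 5 := Nat.le_mul_of_pos_left _ hb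
      exact_mod_cast this
    exact this
  have hω2 : ω ≤ 2 := by
    by_contra hc
    push Not at hc
    have := pow_lt_pow_left₀ hc (by norm_num) (n := 5) (by norm_num)
    rw [hω5] at this; linarith
  have e0 : θ * x0 = ω * y0 := by
    apply (pow_left_inj₀ (by positivity) (by positivity) (n := 5) (by norm_num)).mp
    rw [mul_pow, mul_pow, hθ5, hω5, hz, hD]
    field_simp
    linarith
  -- η
  set η : ℝ := θ * x / y - 1 with hη
  have e1 : θ * x = (1 + η) * y := by rw [hη]; field_simp; ring
  have hη5 : (1 + η) ^ 5 = 1 + B / (b * y ^ 5) := by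
    rw [hη, add_sub_cancel, div_pow, mul_pow, hθ5]
    field_simp
    linarith
  have hη1pos : 0 ≤ 1 + η := by rw [hη]; simp; positivity
  have hBy : (0:ℝ) < B / (b * y ^ 5) := by positivity
  have hη0 : 0 ≤ η := by
    by_contra hc
    push Not at hc
    have := pow_lt_one₀ hη1pos (by linarith) (n := 5) (by norm_num)
    linarith
  have hηle : η ≤ B / (b * y ^ 5) := by
    have : (1 + η) ^ 5 = 1 + 5 * η + 10 * η ^ 2 + 10 * η ^ 3 + 5 * η ^ 4 + η ^ 5 := by ring
    have : 0 ≤ η ^ 2 ∧ 0 ≤ η ^ 3 ∧ 0 ≤ η ^ 4 ∧ 0 ≤ η ^ 5 := by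
      refine ⟨?_, ?_, ?_, ?_⟩ <;> positivity
    linarith
  have hη1 : η ≤ 1 := by
    refine hηle.trans ?_
    rw [div_le_one (by positivity)]
    have : B ≤ b * y ^ 5 := by
      calc B ≤ y := by
            refine le_trans ?_ hy.le
            calc B ≤ 16 * B ^ 2 := by nlinarith
              _ ≤ (16 * B ^ 2) ^ 5 := Nat.le_self_pow (by norm_num) _
              _ ≤ _ := Nat.le_mul_of_pos_right _ (by positivity)
        _ ≤ y ^ 5 := Nat.le_self_pow (by norm_num) _
        _ ≤ _ := Nat.le_mul_of_pos_left _ hb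
    exact_mod_cast this
  have hηge : B / (b * y ^ 5) ≤ 31 * η := by
    have : (1 + η) ^ 5 = 1 + 5 * η + 10 * η ^ 2 + 10 * η ^ 3 + 5 * η ^ 4 + η ^ 5 := by ring
    have h2 : η ^ 2 ≤ η := by nlinarith
    have h3 : η ^ 3 ≤ η := by nlinarith [mul_nonneg hη0 hη0]
    have h4 : η ^ 4 ≤ η := by
      calc η ^ 4 = η ^ 3 * η := by ring
        _ ≤ 1 * η := by gcongr; linarith
        _ = η := one_mul _
    have h5 : η ^ 5 ≤ η := by
      calc η ^ 5 = η ^ 4 * η := by ring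
        _ ≤ 1 * η := by gcongr; linarith
        _ = η := one_mul _
    linarith
  -- remainder is small
  have hc1 : (124:ℝ) * (8 * B ^ 2) ^ n * y ^ 5 < y0 ^ (10 * n + 5) := by exact_mod_cast c1
  have hsmall : 4 * 8 ^ n * z ^ (2 * n + 1) < η := by
    have : 124 * 8 ^ n * z ^ (2 * n + 1) < B / (b * y ^ 5) := by
      have hz2 : z ^ (2 * n) ≤ (B ^ 2) ^ n / y0 ^ (10 * n) := by
        have : z ≤ B / y0 ^ 5 := by
          rw [hz, hD]
          gcongr
          exact le_mul_of_one_le_left (by positivity) hb'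
        calc z ^ (2 * n) ≤ (B / y0 ^ 5) ^ (2 * n) := by gcongr
          _ = _ := by rw [div_pow]; congr 1 <;> ring
      calc 124 * 8 ^ n * z ^ (2 * n + 1) = 124 * 8 ^ n * z ^ (2 * n) * z := by ring
        _ ≤ 124 * 8 ^ n * ((B ^ 2) ^ n / y0 ^ (10 * n)) * z := by gcongr
        _ < B / (b * y ^ 5) := by
          rw [hz, hD, lt_div_iff₀ (by positivity)]
          have : 124 * 8 ^ n * ((B ^ 2) ^ n / (y0:ℝ) ^ (10 * n)) * (B / (b * y0 ^ 5)) * (b * y ^ 5) =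
            (124 * (8 * B ^ 2) ^ n * y ^ 5) / (y0 ^ (10 * n + 5)) * B := by
            rw [mul_pow, pow_add]; field_simp
          rw [this]
          have : (124 * (8 * (B:ℝ) ^ 2) ^ n * y ^ 5) / (y0 ^ (10 * n + 5)) < 1 := by
            rw [div_lt_one (by positivity)]; exact hc1
          nlinarith
    linarith
  -- the integer
  set R : ℝ := ω * Q - P with hR
  have hL : θ * ((x * y0 * P - x0 * y * Q : ℤ) : ℝ) = y * y0 * (η * ω * Q - (1 + η) * R) := by
    push_cast
    rw [hR]
    linear_combination (y0 * P : ℝ) * e1 - (y * Q : ℝ) * e0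
  have h25 : 0 < (25 * D) ^ n := by positivity
  have hQpos : (0:ℝ) < Q := by linarith
  have h200 : (200 * D) ^ n = (25 * D) ^ n * 8 ^ n := by rw [← mul_pow]; ring
  have hRs : |(1 + η) * R| < η * ω * Q := by
    rw [abs_mul, abs_of_nonneg hη1pos]
    calc (1 + η) * |R| ≤ 2 * (2 * (200 * D) ^ n * z ^ (2 * n + 1)) := by gcongr; linarith
      _ = (25 * D) ^ n * (4 * 8 ^ n * z ^ (2 * n + 1)) := by rw [h200]; ring
      _ < (25 * D) ^ n * η := by gcongr
      _ ≤ Q * η := by gcongr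
      _ = η * 1 * Q := by ring
      _ ≤ η * ω * Q := by gcongr
  have hRs' := abs_lt.mp hRs
  have hLpos : 0 < θ * ((x * y0 * P - x0 * y * Q : ℤ) : ℝ) := by
    rw [hL]; apply mul_pos (by positivity); linarith
  have hLge : (1 : ℝ) ≤ ((x * y0 * P - x0 * y * Q : ℤ) : ℝ) := by
    have := pos_of_mul_pos_right hLpos hθpos.le
    have h2 : (0 : ℤ) < x * y0 * P - x0 * y * Q := by exact_mod_cast this
    exact_mod_cast h2
  have hθle : θ ≤ y * y0 * (4 * η * (200 * D) ^ n) := by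
    calc θ ≤ θ * ((x * y0 * P - x0 * y * Q : ℤ) : ℝ) := le_mul_of_one_le_right hθpos.le hLge
      _ = y * y0 * (η * ω * Q - (1 + η) * R) := hL
      _ ≤ y * y0 * (2 * (η * ω * Q)) := by gcongr; linarith
      _ ≤ y * y0 * (2 * (η * 2 * (200 * D) ^ n)) := by gcongr
      _ = _ := by ring
  have hθge : 1 / (b:ℝ) ≤ θ := by
    by_contra hc
    push Not at hc
    have h1 := pow_lt_pow_left₀ hc hθpos.le (n := 5) (by norm_num)
    rw [hθ5, div_pow, one_pow, div_lt_div_iff₀ (by positivity) (by positivity)] at h1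
    have h2 : (b : ℝ) ≤ b ^ 5 := le_self_pow₀ hb' (by norm_num)
    have h3 : (1:ℝ) ≤ a := by exact_mod_cast ha
    nlinarith
  have hc2 : (4:ℝ) * B * y0 * (E * y0 ^ 5) ^ n < y ^ 4 := by exact_mod_cast c2
  have hE2' : (200:ℝ) * b ≤ E := by exact_mod_cast hE2
  have : y * y0 * (4 * η * (200 * D) ^ n) < 1 / b := by
    calc y * y0 * (4 * η * (200 * D) ^ n) ≤ y * y0 * (4 * (B / (b * y ^ 5)) * (E * y0 ^ 5) ^ n) := by
          have : 200 * D ≤ E * y0 ^ 5 := by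
            rw [hD, ← mul_assoc]; gcongr
          gcongr
      _ = (4 * B * y0 * (E * y0 ^ 5) ^ n) / y ^ 4 / b := by field_simp
      _ < 1 / b := by
          gcongr
          rw [div_lt_one (by positivity)]; exact hc2
  linarith

theorem thue (a b B : ℕ) (ha : 0 < a) (hb : 0 < b) (hB : 0 < B) :
    {s : ℕ × ℕ | a * s.1 ^ 5 = b * s.2 ^ 5 + B}.Finite := by
  by_contra hinf
  have hunb : ∀ Y : ℕ, ∃ x y : ℕ, a * x ^ 5 = b * y ^ 5 + B ∧ Y < y := by
    intro Y
    by_contra hc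
    push Not at hc
    apply hinf
    apply Set.Finite.subset (Set.Finite.prod (Set.finite_Iic (b * Y ^ 5 + B)) (Set.finite_Iic Y))
    rintro ⟨x, y⟩ hxy
    simp only [Set.mem_ofPred_eq] at hxy
    have hy := hc x y hxy
    refine ⟨?_, hy⟩
    simp only [Set.mem_Iic]
    calc x ≤ x ^ 5 := Nat.le_self_pow (by norm_num) _
      _ ≤ a * x ^ 5 := Nat.le_mul_of_pos_left _ ha
      _ = b * y ^ 5 + B := hxy
      _ ≤ _ := by gcongr
  obtain ⟨x0, y0, h0, hy0⟩ := hunb ((8 * B ^ 2 + 200 * b) ^ 2)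
  obtain ⟨x, y, h, hy⟩ := hunb ((16 * B ^ 2) ^ 5 * y0 ^ 65)
  exact thue_core a b B (8 * B ^ 2 + 200 * b) x0 y0 x y ha hb hB h0 h (by omega) (by omega) hy0.le hy

theorem thue_int_pos (a b B : ℤ) (ha : 0 < a) (hb : b ≠ 0) (hB : B ≠ 0) :
    {s : ℕ × ℕ | a * (s.1 : ℤ) ^ 5 = b * (s.2 : ℤ) ^ 5 + B}.Finite := by
  lift a to ℕ using ha.le
  have ha' : 0 < a := by exact_mod_cast ha
  rcases lt_or_gt_of_ne hb with hb | hb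
  · apply Set.Finite.subset (Set.Finite.prod (Set.finite_Iic B.natAbs) (Set.finite_Iic B.natAbs))
    rintro ⟨x, y⟩ hxy
    simp only [Set.mem_ofPred_eq] at hxy
    have h1 : (x : ℤ) ≤ (x : ℤ) ^ 5 := by exact_mod_cast Nat.le_self_pow (by norm_num) _
    have h2 : (y : ℤ) ≤ (y : ℤ) ^ 5 := by exact_mod_cast Nat.le_self_pow (by norm_num) _
    have h3 : (0:ℤ) ≤ (x : ℤ) ^ 5 := by positivity
    have h4 : (0:ℤ) ≤ (y : ℤ) ^ 5 := by positivity
    have h5 : (x : ℤ) ^ 5 ≤ a * (x : ℤ) ^ 5 := by nlinarith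
    have h6 : (y : ℤ) ^ 5 ≤ -b * (y : ℤ) ^ 5 := by nlinarith
    constructor <;> simp only [Set.mem_Iic] <;> zify <;> apply le_abs.mpr <;> left <;> linarith
  · lift b to ℕ using hb.le
    have hb' : 0 < b := by exact_mod_cast hb
    rcases lt_or_gt_of_ne hB with hB | hB
    · obtain ⟨C, rfl⟩ : ∃ C : ℕ, B = -C := ⟨B.natAbs, by omega⟩
      have := (thue b a C hb' ha' (by omega)).preimage (f := Prod.swap)
        (Prod.swap_injective.injOn)
      refine this.subset ?_
      rintro ⟨x, y⟩ hxy
      simp only [Set.mem_ofPred_eq, Set.mem_preimage, Prod.swap] at hxy ⊢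
      zify; linarith
    · lift B to ℕ using hB.le
      refine (thue a b B ha' hb' (by exact_mod_cast hB)).subset ?_
      rintro ⟨x, y⟩ hxy
      simp only [Set.mem_ofPred_eq] at hxy ⊢
      exact_mod_cast hxy

theorem thue_int (a b B : ℤ) (ha : a ≠ 0) (hb : b ≠ 0) (hB : B ≠ 0) :
    {s : ℕ × ℕ | a * (s.1 : ℤ) ^ 5 = b * (s.2 : ℤ) ^ 5 + B}.Finite := by
  rcases lt_or_gt_of_ne ha with h | h
  · refine (thue_int_pos (-a) (-b) (-B) (by omega) (by omega) (by omega)).subset ?_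
    rintro ⟨x, y⟩ hxy
    simp only [Set.mem_ofPred_eq] at hxy ⊢
    linarith
  · exact thue_int_pos a b B h hb hB

theorem exp_eq_finite (A R B l : ℤ) (p : ℕ) (hA : A ≠ 0) (hR : R ≠ 0) (hB : B ≠ 0)
    (hl : 2 ≤ l.natAbs) (hp : 2 ≤ p) :
    {j : ℕ | ∃ m : ℕ, A * l ^ j = R * (p : ℤ) ^ m + B}.Finite := by
  have hl0 : l ≠ 0 := by rintro rfl; simp at hl
  have hp0 : (p : ℤ) ≠ 0 := by positivity
  have hfin : ∀ r s : ℕ, {t : ℕ × ℕ | (A * l ^ r) * (t.1 : ℤ) ^ 5 =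
      (R * (p : ℤ) ^ s) * (t.2 : ℤ) ^ 5 + B}.Finite := fun r s =>
    thue_int _ _ _ (mul_ne_zero hA (pow_ne_zero _ hl0)) (mul_ne_zero hR (pow_ne_zero _ hp0)) hB
  have hbig : (⋃ r ∈ range 10, ⋃ s ∈ range 5, ⋃ t ∈ {t : ℕ × ℕ | (A * l ^ r) * (t.1 : ℤ) ^ 5 =
      (R * (p : ℤ) ^ s) * (t.2 : ℤ) ^ 5 + B}, Set.Iic (10 * t.1 + 9)).Finite := by
    apply Set.Finite.biUnion (finite_toSet (range 10))
    intro r _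
    apply Set.Finite.biUnion (finite_toSet (range 5))
    intro s _
    exact Set.Finite.biUnion (hfin r s) (fun t _ => Set.finite_Iic _)
  refine hbig.subset ?_
  rintro j ⟨m, hm⟩
  simp only [Set.mem_iUnion]
  refine ⟨j % 10, by simp; omega, m % 5, by simp; omega,
    (l.natAbs ^ (2 * (j / 10)), p ^ (m / 5)), ?_, ?_⟩
  · simp only [Set.mem_ofPred_eq]
    push_cast
    have e1 : (|l| ^ (2 * (j / 10))) ^ 5 = l ^ (10 * (j / 10)) := by
      rw [pow_mul, sq_abs]; ring
    have e2 : ((p : ℤ) ^ (m / 5)) ^ 5 = p ^ (5 * (m / 5)) := by ring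
    rw [e1, e2, mul_assoc, mul_assoc, ← pow_add, ← pow_add, Nat.mod_add_div, Nat.mod_add_div]
    exact hm
  · simp only [Set.mem_Iic]
    have : 2 * (j / 10) < l.natAbs ^ (2 * (j / 10)) := Nat.lt_pow_self (by omega)
    omega

/-- Eventually periodic sequences. -/
def EPf {X : Type*} (f : ℕ → X) : Prop := ∃ N a : ℕ, 0 < a ∧ ∀ n, N ≤ n → f (n + a) = f n

theorem EPf.mul_aux {X : Type*} {f : ℕ → X} {N a : ℕ} (h : ∀ n, N ≤ n → f (n + a) = f n) (t : ℕ) :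
    ∀ n, N ≤ n → f (n + a * t) = f n := by
  induction t with
  | zero => intro n _; simp
  | succ t ih =>
    intro n hn
    have := h (n + a * t) (by omega)
    rw [show n + a * (t + 1) = n + a * t + a by ring, this, ih n hn]

theorem EPf.comp {X Y : Type*} {f : ℕ → X} (h : EPf f) (F : X → Y) : EPf (fun n => F (f n)) := by
  obtain ⟨N, a, ha, H⟩ := h
  exact ⟨N, a, ha, fun n hn => by simp only [H n hn]⟩

theorem EPf.pair {X Y : Type*} {f : ℕ → X} {g : ℕ → Y} (hf : EPf f) (hg : EPf g) :
    EPf (fun n => (f n, g n)) := by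
  obtain ⟨N, a, ha, H⟩ := hf
  obtain ⟨N', a', ha', H'⟩ := hg
  refine ⟨max N N', a * a', by positivity, fun n hn => ?_⟩
  have h1 := EPf.mul_aux H a' n (le_trans (le_max_left _ _) hn)
  have h2 := EPf.mul_aux H' a n (le_trans (le_max_right _ _) hn)
  rw [mul_comm a' a] at h2
  simp only [h1, h2]

theorem EPf.const {X : Type*} (x : X) : EPf (fun _ : ℕ => x) := ⟨0, 1, one_pos, fun _ _ => rfl⟩

theorem EPf.and {P Q : ℕ → Prop} (hP : EPf P) (hQ : EPf Q) : EPf (fun n => P n ∧ Q n) :=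
  (hP.pair hQ).comp (fun x => x.1 ∧ x.2)

theorem EPf.congr {X : Type*} {f g : ℕ → X} (h : EPf f) (hfg : ∀ n, g n = f n) : EPf g := by
  have : g = f := funext hfg
  rwa [this]

theorem EPf.forall_fin {r : ℕ} {P : Fin r → ℕ → Prop} (h : ∀ i, EPf (P i)) :
    EPf (fun n => ∀ i, P i n) := by
  induction r with
  | zero => exact (EPf.const True).congr (fun n => by simp)
  | succ r ih =>
    refine ((h 0).and (ih (P := fun i => P i.succ) (fun i => h i.succ))).congr ?_
    intro n
    simp only [Fin.forall_fin_succ]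

theorem EPf.of_finite {S : Set ℕ} (h : S.Finite) : EPf (fun n => n ∈ S) := by
  obtain ⟨b, hb⟩ := h.bddAbove
  refine ⟨b + 1, 1, one_pos, fun n hn => ?_⟩
  apply propext
  constructor
  · intro h1; have := hb h1; omega
  · intro h1; have := hb h1; omega

theorem EPf.of_iter {X : Type*} [Finite X] {s : ℕ → X} (F : X → X) (h : ∀ n, s (n + 1) = F (s n)) :
    EPf s := by
  obtain ⟨m, n, hmn, he⟩ := Finite.exists_ne_map_eq_of_infinite s
  wlog hlt : m < n generalizing m n
  · exact this n m hmn.symm he.symm (by omega)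
  refine ⟨m, n - m, by omega, fun j hj => ?_⟩
  induction j, hj using Nat.le_induction with
  | base => rw [show m + (n - m) = n by omega, he]
  | succ j _ ih => rw [show j + 1 + (n - m) = j + (n - m) + 1 by omega, h, ih, h]

/-- Finite unions of arithmetic progressions and `p`-arithmetic sequences. -/
def GoodSet (p : ℕ) (S : Set ℕ) : Prop :=
  ∃ (M : ℕ) (f : Fin M → Set ℕ), (∀ i, IsAPNat (f i) ∨ IsPArithSeqNat p (f i)) ∧ S = ⋃ i, f i

theorem GoodSet.empty (p : ℕ) : GoodSet p ∅ := ⟨0, fun _ => ∅, fun i => i.elim0, by simp⟩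

theorem GoodSet.union {p : ℕ} {S T : Set ℕ} (hS : GoodSet p S) (hT : GoodSet p T) :
    GoodSet p (S ∪ T) := by
  obtain ⟨M, f, hf, rfl⟩ := hS
  obtain ⟨M', f', hf', rfl⟩ := hT
  refine ⟨M + M', Fin.append f f', ?_, ?_⟩
  · intro i
    refine Fin.addCases (fun i => ?_) (fun i => ?_) i
    · simpa using hf i
    · simpa using hf' i
  · ext n
    simp only [Set.mem_union, Set.mem_iUnion]
    constructor
    · rintro (⟨i, hi⟩ | ⟨i, hi⟩)
      · exact ⟨Fin.castAdd M' i, by simpa using hi⟩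
      · exact ⟨Fin.natAdd M i, by simpa using hi⟩
    · rintro ⟨i, hi⟩
      revert hi
      refine Fin.addCases (fun i hi => ?_) (fun i hi => ?_) i
      · exact Or.inl ⟨i, by simpa using hi⟩
      · exact Or.inr ⟨i, by simpa using hi⟩

theorem GoodSet.range_union {p : ℕ} (N : ℕ) {T : ℕ → Set ℕ} (h : ∀ i < N, GoodSet p (T i)) :
    GoodSet p {n | ∃ i < N, n ∈ T i} := by
  induction N with
  | zero => simpa using GoodSet.empty p
  | succ N ih =>
    have : {n | ∃ i < N + 1, n ∈ T i} = {n | ∃ i < N, n ∈ T i} ∪ T N := by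
      ext n
      simp only [Set.mem_union, Set.mem_ofPred_eq]
      constructor
      · rintro ⟨i, hi, hn⟩
        rcases Nat.lt_succ_iff_lt_or_eq.mp hi with h1 | rfl
        · exact Or.inl ⟨i, h1, hn⟩
        · exact Or.inr hn
      · rintro (⟨i, hi, hn⟩ | hn)
        · exact ⟨i, by omega, hn⟩
        · exact ⟨N, by omega, hn⟩
    rw [this]
    exact (ih (fun i hi => h i (by omega))).union (h N (by omega))

theorem GoodSet.ap (p m l : ℕ) : GoodSet p {n | ∃ j : ℕ, n = m * j + l} :=
  ⟨1, fun _ => {n | ∃ j : ℕ, n = m * j + l}, fun _ => Or.inl ⟨m, l, rfl⟩, by simp [Set.iUnion_const]⟩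

theorem GoodSet.pa (p : ℕ) (a b : ℚ) (k : ℕ) :
    GoodSet p {n : ℕ | ∃ j : ℕ, (n : ℚ) = a * (p : ℚ) ^ (k * j) + b} :=
  ⟨1, fun _ => {n : ℕ | ∃ j : ℕ, (n : ℚ) = a * (p : ℚ) ^ (k * j) + b},
    fun _ => Or.inr ⟨a, b, k, rfl⟩, by simp [Set.iUnion_const]⟩

/-- decomposition of an index set along an eventually periodic predicate -/
theorem GoodSet.of_classes {p : ℕ} {I : ℕ → Prop} (hI : EPf I) (T : ℕ → Set ℕ)
    (h1 : ∀ i, GoodSet p (T i)) (h2 : ∀ i t, GoodSet p {n | ∃ s, n ∈ T (i + t * s)}) :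
    GoodSet p {n | ∃ i, I i ∧ n ∈ T i} := by
  obtain ⟨N, a, ha, H⟩ := hI
  classical
  have key : {n | ∃ i, I i ∧ n ∈ T i} =
      {n | ∃ i < N, n ∈ (if I i then T i else ∅)} ∪
      {n | ∃ r < a, n ∈ (if I (N + r) then {n | ∃ s, n ∈ T (N + r + a * s)} else ∅)} := by
    ext n
    simp only [Set.mem_union, Set.mem_ofPred_eq]
    constructor
    · rintro ⟨i, hi, hn⟩
      by_cases hiN : i < N
      · exact Or.inl ⟨i, hiN, by rw [if_pos hi]; exact hn⟩
      · right
        have e : i = N + (i - N) % a + a * ((i - N) / a) := by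
          have := Nat.mod_add_div (i - N) a
          omega
        refine ⟨(i - N) % a, Nat.mod_lt _ ha, ?_⟩
        have := EPf.mul_aux H ((i - N) / a) (N + (i - N) % a) (by omega)
        rw [← e] at this
        rw [if_pos (this ▸ hi)]
        exact ⟨(i - N) / a, e ▸ hn⟩
    · rintro (⟨i, hi, hn⟩ | ⟨r, hr, hn⟩)
      · split_ifs at hn with h
        · exact ⟨i, h, hn⟩
        · exact absurd hn (by simp)
      · split_ifs at hn with h
        · obtain ⟨s, hs⟩ := hn
          exact ⟨N + r + a * s, by rw [EPf.mul_aux H s (N + r) (by omega)]; exact h, hs⟩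
        · exact absurd hn (by simp)
  rw [key]
  refine (GoodSet.range_union N fun i _ => ?_).union (GoodSet.range_union a fun r _ => ?_)
  · split_ifs
    · exact h1 i
    · exact GoodSet.empty p
  · split_ifs
    · exact h2 _ _
    · exact GoodSet.empty p

theorem GoodSet.of_EP {p : ℕ} {I : ℕ → Prop} (hI : EPf I) : GoodSet p {n | I n} := by
  have := GoodSet.of_classes (p := p) hI (fun i => {i}) (fun i => ?_) (fun i t => ?_)
  · convert this using 1
    ext n
    simp
  · have := GoodSet.ap p 0 i
    convert this using 1
    ext n; simp
  · have := GoodSet.ap p t i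
    convert this using 1
    ext n
    simp [add_comm]

theorem GoodSet.of_pa {p : ℕ} {I : ℕ → Prop} (hI : EPf I) (A B : ℚ) (k : ℕ) :
    GoodSet p {n : ℕ | ∃ i, I i ∧ (n : ℚ) = A * (p : ℚ) ^ (k * i) + B} := by
  refine GoodSet.of_classes hI (fun i => {n : ℕ | (n : ℚ) = A * (p : ℚ) ^ (k * i) + B})
    (fun i => ?_) (fun i t => ?_)
  · have := GoodSet.pa p 0 (A * (p : ℚ) ^ (k * i) + B) 0
    convert this using 1
    ext n; simp
  · have := GoodSet.pa p (A * (p : ℚ) ^ (k * i)) B (k * t)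
    convert this using 1
    ext n
    simp only [Set.mem_ofPred_eq]
    refine exists_congr fun s => ?_
    rw [mul_assoc A, ← pow_add]
    ring_nf

/-- Sets stable under affine images, and good. -/
def NiceSet (p : ℕ) (S : Set ℕ) : Prop :=
  EPf (fun n => n ∈ S) ∨ ∃ (A B : ℚ) (k : ℕ) (I : ℕ → Prop), EPf I ∧
    (∀ i, I i → ∃ j : ℕ, (j : ℚ) = A * (p : ℚ) ^ (k * i) + B) ∧
    S = {j : ℕ | ∃ i, I i ∧ (j : ℚ) = A * (p : ℚ) ^ (k * i) + B}

theorem NiceSet.image_good {p : ℕ} {S : Set ℕ} (h : NiceSet p S) (a b : ℕ) :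
    GoodSet p {n | ∃ j ∈ S, n = a * j + b} := by
  rcases h with h | ⟨A, B, k, I, hI, hn, rfl⟩
  · refine GoodSet.of_classes h (fun j => {n | n = a * j + b}) (fun i => ?_) (fun i t => ?_)
    · have := GoodSet.ap p 0 (a * i + b)
      convert this using 1
      ext n; simp
    · have := GoodSet.ap p (a * t) (a * i + b)
      convert this using 1
      ext n
      simp only [Set.mem_ofPred_eq]
      refine exists_congr fun s => ?_
      ring_nf
  · have := GoodSet.of_pa (p := p) hI (a * A) (a * B + b) k
    convert this using 1
    ext n
    simp only [Set.mem_ofPred_eq]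
    constructor
    · rintro ⟨j, ⟨i, hi, hj⟩, rfl⟩
      refine ⟨i, hi, ?_⟩
      push_cast
      rw [hj]; ring
    · rintro ⟨i, hi, hj⟩
      obtain ⟨j, hj'⟩ := hn i hi
      refine ⟨j, ⟨i, hi, hj'⟩, ?_⟩
      have : (n : ℚ) = ((a * j + b : ℕ) : ℚ) := by
        push_cast
        rw [hj, hj']; ring
      exact_mod_cast this

theorem EPf.pow_mod (D : ℕ) (hD : D ≠ 0) (x : ℤ) : EPf (fun m => ((x ^ m : ℤ) : ZMod D)) := by
  have : NeZero D := ⟨hD⟩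
  refine EPf.of_iter (fun z => z * (x : ZMod D)) fun n => ?_
  push_cast
  rw [pow_succ]

theorem num_linear_EP {X : Type*} (p k : ℕ) (hp : 2 ≤ p) (hk : 1 ≤ k) (ρ d t0 : ℤ) (hρ : 0 < ρ) (hd : 0 < d)
    (f g : ℕ → X) (hf : EPf f) (hg : EPf g) :
    EPf (fun m : ℕ => ∃ j : ℕ, d * j = ρ * (p : ℤ) ^ (m * k) - t0 ∧ f j = g m) := by
  obtain ⟨N, a, ha, Hf⟩ := hf
  obtain ⟨N', a', ha', Hg⟩ := hg
  have hD : (d * a).natAbs ≠ 0 := by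
    rw [Int.natAbs_ne_zero]; positivity
  obtain ⟨N2, b, hb, Hm⟩ := EPf.pow_mod (d * a).natAbs hD ((p : ℤ) ^ k)
  refine ⟨max N' N2 + (d * N + |t0|).toNat, b * a', by positivity, fun m hm => ?_⟩
  have hmN' : N' ≤ m := le_trans (le_trans (le_max_left _ _) (Nat.le_add_right _ _)) hm
  have hmN2 : N2 ≤ m := le_trans (le_trans (le_max_right _ _) (Nat.le_add_right _ _)) hm
  have hmb : d * N + |t0| ≤ m := by
    have : (d * N + |t0|).toNat ≤ m := le_trans (Nat.le_add_left _ _) hm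
    exact Int.toNat_le.mp this
  have hg' := EPf.mul_aux Hg b m hmN'
  rw [mul_comm a' b] at hg'
  have hm' := EPf.mul_aux (f := fun m => (((((p : ℤ) ^ k) ^ m : ℤ)) : ZMod (d * a).natAbs)) Hm a' m hmN2
  have hdiv : (d * a) ∣ ((p : ℤ) ^ ((m + b * a') * k) - (p : ℤ) ^ (m * k)) := by
    rw [← Int.natAbs_dvd, ← ZMod.intCast_zmod_eq_zero_iff_dvd]
    · simp only [← pow_mul] at hm'
      rw [Int.cast_sub, mul_comm (m + b * a') k, mul_comm m k, hm', sub_self]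
  obtain ⟨t, ht⟩ := hdiv
  have ht0 : 0 ≤ t := by
    have h1 : (0 : ℤ) ≤ (p : ℤ) ^ ((m + b * a') * k) - (p : ℤ) ^ (m * k) := by
      rw [sub_nonneg]
      apply pow_le_pow_right₀ (by omega)
      apply Nat.mul_le_mul_right; omega
    rw [ht] at h1
    have : 0 < d * a := by positivity
    exact nonneg_of_mul_nonneg_right h1 this
  have hbig : (m : ℤ) ≤ ρ * (p : ℤ) ^ (m * k) := by
    have h1 : m < p ^ (m * k) := lt_of_lt_of_le (Nat.lt_pow_self (by omega : 1 < p))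
      (Nat.pow_le_pow_right (by omega) (Nat.le_mul_of_pos_right _ (by omega)))
    have h2 : (m : ℤ) < (p : ℤ) ^ (m * k) := by exact_mod_cast h1
    nlinarith [pow_pos (by omega : (0:ℤ) < p) (m * k)]
  have habs := le_abs_self t0
  have hr0 : 0 ≤ ρ * t := by positivity
  obtain ⟨s, hs⟩ := Int.eq_ofNat_of_zero_le hr0
  apply propext
  constructor
  · rintro ⟨j, hj, hfj⟩
    -- j - a * s
    have hNj : d * N ≤ d * (j - a * s) := by
      have : d * (j - a * s) = ρ * (p : ℤ) ^ (m * k) - t0 := by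
        rw [← hs]
        linear_combination hj + ρ * ht
      rw [this]; linarith
    have hNj' : (N : ℤ) ≤ j - a * s := le_of_mul_le_mul_left hNj hd
    have hle : N + a * s ≤ j := by
      have : ((N + a * s : ℕ) : ℤ) ≤ j := by push_cast; linarith
      exact_mod_cast this
    obtain ⟨i, rfl⟩ := Nat.exists_eq_add_of_le' (le_trans (Nat.le_add_left (a * s) N) hle)
    refine ⟨i, ?_, ?_⟩
    · push_cast at hj
      rw [← hs] at hj
      linear_combination hj + ρ * ht
    · rw [← hg', ← hfj, EPf.mul_aux Hf s i (by omega)]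
  · rintro ⟨j, hj, hfj⟩
    have hNj : d * N ≤ d * j := by rw [hj]; linarith
    have hNj' : (N : ℤ) ≤ j := le_of_mul_le_mul_left hNj hd
    refine ⟨j + a * s, ?_, ?_⟩
    · push_cast
      rw [← hs]
      linear_combination hj - ρ * ht
    · rw [hg', ← hfj, EPf.mul_aux Hf s j (by exact_mod_cast hNj')]

theorem num_linear {X : Type*} (p k : ℕ) (hp : 2 ≤ p) (hk : 1 ≤ k) (ρ d t0 : ℤ) (hρ : ρ ≠ 0) (hd : 0 < d)
    (f g : ℕ → X) (hf : EPf f) (hg : EPf g) :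
    NiceSet p {j : ℕ | ∃ m : ℕ, t0 + d * j = ρ * (p : ℤ) ^ (m * k) ∧ f j = g m} := by
  rcases lt_or_gt_of_ne hρ with h | h
  · left
    refine EPf.of_finite (Set.Finite.subset (Set.finite_Iic (|t0|).toNat) ?_)
    rintro j ⟨m, hm, -⟩
    have h1 : (0 : ℤ) < (p : ℤ) ^ (m * k) := pow_pos (by omega) _
    have h2 : t0 + d * j < 0 := by rw [hm]; exact mul_neg_of_neg_of_pos h h1
    have h3 := neg_abs_le t0
    have h4 : (j : ℤ) ≤ d * j := by nlinarith [Int.natCast_nonneg j]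
    simp only [Set.mem_Iic]
    have : (j : ℤ) ≤ |t0| := by linarith
    omega
  · right
    have hdq : (d : ℚ) ≠ 0 := by exact_mod_cast hd.ne'
    have hiff : ∀ j m : ℕ, (d * j = ρ * (p : ℤ) ^ (m * k) - t0) ↔
        (j : ℚ) = (ρ / d : ℚ) * (p : ℚ) ^ (k * m) + (-t0 / d : ℚ) := by
      intro j m
      rw [mul_comm k m]
      have : (j : ℚ) = (ρ / d : ℚ) * (p : ℚ) ^ (m * k) + (-t0 / d : ℚ) ↔
          (d * j : ℚ) = ρ * (p : ℚ) ^ (m * k) - t0 := by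
        rw [← mul_right_inj' hdq]
        have : (d : ℚ) * ((ρ / d : ℚ) * (p : ℚ) ^ (m * k) + (-t0 / d : ℚ)) =
          ρ * (p : ℚ) ^ (m * k) - t0 := by field_simp; ring
        rw [this]
      rw [this]
      exact_mod_cast Iff.rfl
    refine ⟨ρ / d, -t0 / d, k, _, num_linear_EP p k hp hk ρ d t0 h hd f g hf hg, ?_, ?_⟩
    · rintro m ⟨j, hj, -⟩
      exact ⟨j, (hiff j m).mp hj⟩
    · ext j
      simp only [Set.mem_ofPred_eq]
      refine exists_congr fun m => ?_
      constructor
      · rintro ⟨h1, h2⟩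
        have h3 : d * j = ρ * (p : ℤ) ^ (m * k) - t0 := by linarith
        exact ⟨⟨j, h3, h2⟩, (hiff j m).mp h3⟩
      · rintro ⟨⟨j', h1, h2⟩, h3⟩
        have h4 := (hiff j m).mpr h3
        have : j' = j := by
          have := h1.trans h4.symm
          have := mul_left_cancel₀ hd.ne' this
          exact_mod_cast this
        subst this
        exact ⟨by linarith, h2⟩

theorem num_exp {X : Type*} (p k : ℕ) (hp : 2 ≤ p) (d K lam : ℤ) (hd : d ≠ 0) (hK : K ≠ 0)
    (hl : 2 ≤ lam.natAbs) (f g : ℕ → X) (hf : EPf f) (hg : EPf g) :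
    EPf (fun j : ℕ => ∃ m : ℕ, d * lam ^ j = K * (p : ℤ) ^ (m * k) ∧ f j = g m) := by
  by_cases hsub : Set.Subsingleton {j : ℕ | ∃ m : ℕ, d * lam ^ j = K * (p : ℤ) ^ (m * k) ∧ f j = g m}
  · exact EPf.of_finite hsub.finite
  have hex : ∃ δ ε : ℕ, 0 < δ ∧ lam ^ δ = (p : ℤ) ^ (ε * k) := by
    simp only [Set.Subsingleton, not_forall] at hsub
    obtain ⟨j1, ⟨m1, h1, -⟩, j2, ⟨m2, h2, -⟩, hne⟩ := hsub
    wlog hlt : j1 < j2 generalizing j1 j2 m1 m2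
    · exact this j2 m2 h2 j1 (Ne.symm hne) m1 h1 (by omega)
    obtain ⟨δ, rfl⟩ := Nat.exists_eq_add_of_lt hlt
    have h3 : (p : ℤ) ^ (m1 * k) * lam ^ (δ + 1) = (p : ℤ) ^ (m2 * k) := by
      apply mul_left_cancel₀ hK
      rw [← h2, ← mul_assoc, ← h1]; ring
    have hpp : (0 : ℤ) < p := by omega
    have hle : m1 * k ≤ m2 * k := by
      by_contra hcon
      push Not at hcon
      have h4 : p ^ (m1 * k) * lam.natAbs ^ (δ + 1) = p ^ (m2 * k) := by
        have := congrArg Int.natAbs h3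
        simpa [Int.natAbs_mul, Int.natAbs_pow] using this
      have h5 : p ^ (m2 * k) < p ^ (m1 * k) := Nat.pow_lt_pow_right (by omega) hcon
      have h6 : 1 ≤ lam.natAbs ^ (δ + 1) := Nat.one_le_pow _ _ (by omega)
      have h7 := Nat.mul_le_mul_left (p ^ (m1 * k)) h6
      omega
    rcases le_or_gt m1 m2 with hm | hm
    · obtain ⟨ε, rfl⟩ := Nat.exists_eq_add_of_le hm
      refine ⟨δ + 1, ε, by omega, ?_⟩
      apply mul_left_cancel₀ (pow_pos hpp (m1 * k)).ne'
      rw [h3]; ring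
    · have : m1 * k = m2 * k := le_antisymm hle (Nat.mul_le_mul_right _ hm.le)
      refine ⟨δ + 1, 0, by omega, ?_⟩
      apply mul_left_cancel₀ (pow_pos hpp (m1 * k)).ne'
      rw [h3, this]; ring
  obtain ⟨δ, ε, hδ, hde⟩ := hex
  obtain ⟨N, a, ha, Hf⟩ := hf
  obtain ⟨N', a', ha', Hg⟩ := hg
  have hpp : (0 : ℤ) < p := by omega
  have hpow : lam ^ (δ * (a * a')) = (p : ℤ) ^ (ε * (a * a') * k) := by
    rw [pow_mul, hde, ← pow_mul]; ring_nf
  set s := a * a' with hs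
  have hbound : ∀ j m : ℕ, d * lam ^ j = K * (p : ℤ) ^ (m * k) → K.natAbs * p ^ (N' * k) < j → N' ≤ m := by
    intro j m h hj
    by_contra hcon
    push Not at hcon
    have h4 : d.natAbs * lam.natAbs ^ j = K.natAbs * p ^ (m * k) := by
      have := congrArg Int.natAbs h
      simpa [Int.natAbs_mul, Int.natAbs_pow] using this
    have h5 : p ^ (m * k) ≤ p ^ (N' * k) :=
      Nat.pow_le_pow_right (by omega) (Nat.mul_le_mul_right _ hcon.le)
    have h6 : j < lam.natAbs ^ j := Nat.lt_pow_self (by omega)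
    have h7 : 1 ≤ d.natAbs := Int.natAbs_pos.mpr hd
    have h8 := Nat.mul_le_mul_left K.natAbs h5
    nlinarith
  refine ⟨N + K.natAbs * p ^ (N' * k) + 1, δ * s, by positivity, fun j hj => ?_⟩
  have hfj : f (j + δ * s) = f j := by
    have := EPf.mul_aux Hf (δ * a') j (by omega)
    rwa [show a * (δ * a') = δ * s by rw [hs]; ring] at this
  have hgm : ∀ m, N' ≤ m → g (m + ε * s) = g m := by
    intro m hm
    have := EPf.mul_aux Hg (ε * a) m hm
    rwa [show a' * (ε * a) = ε * s by rw [hs]; ring] at this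
  apply propext
  constructor
  · rintro ⟨m, hm, hfg⟩
    have hpos : (0 : ℤ) < (p : ℤ) ^ (ε * s * k) := pow_pos hpp _
    rw [pow_add, hpow] at hm
    have hge : ε * s ≤ m ∨ m * k < ε * s * k := by
      rcases le_or_gt (ε * s) m with h | h
      · exact Or.inl h
      · rcases Nat.eq_zero_or_pos k with rfl | hk
        · exfalso
          have h4 : d.natAbs * lam.natAbs ^ j = K.natAbs := by
            have := congrArg Int.natAbs hm
            simpa [Int.natAbs_mul, Int.natAbs_pow] using this
          have h6 : j < lam.natAbs ^ j := Nat.lt_pow_self (by omega)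
          have h7 : 1 ≤ d.natAbs := Int.natAbs_pos.mpr hd
          simp at hj
          nlinarith
        · right; exact Nat.mul_lt_mul_of_pos_right h hk
    rcases hge with hge | hge
    · obtain ⟨i, rfl⟩ := Nat.exists_eq_add_of_le' hge
      have h1 : d * lam ^ j = K * (p : ℤ) ^ (i * k) := by
        apply mul_right_cancel₀ hpos.ne'
        rw [mul_assoc, hm]; ring
      refine ⟨i, h1, ?_⟩
      rw [← hfj, hfg, hgm i (hbound j i h1 (by omega))]
    · exfalso
      have h4 : d.natAbs * (lam.natAbs ^ j * p ^ (ε * s * k)) = K.natAbs * p ^ (m * k) := by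
        have := congrArg Int.natAbs hm
        simpa [Int.natAbs_mul, Int.natAbs_pow] using this
      have h5 : p ^ (m * k) < p ^ (ε * s * k) := Nat.pow_lt_pow_right (by omega) hge
      have h6 : j < lam.natAbs ^ j := Nat.lt_pow_self (by omega)
      have h7 : 1 ≤ d.natAbs := Int.natAbs_pos.mpr hd
      have h9 : K.natAbs ≤ K.natAbs * p ^ (N' * k) := Nat.le_mul_of_pos_right _ (by positivity)
      have h10 : K.natAbs < lam.natAbs ^ j := by omega
      have h11 : K.natAbs * p ^ (m * k) ≤ K.natAbs * p ^ (ε * s * k) := Nat.mul_le_mul_left _ h5.le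
      have h12 : K.natAbs * p ^ (ε * s * k) < lam.natAbs ^ j * p ^ (ε * s * k) :=
        Nat.mul_lt_mul_of_pos_right h10 (by positivity)
      have h13 : lam.natAbs ^ j * p ^ (ε * s * k) ≤ d.natAbs * (lam.natAbs ^ j * p ^ (ε * s * k)) :=
        Nat.le_mul_of_pos_left _ h7
      omega
  · rintro ⟨m, hm, hfg⟩
    refine ⟨m + ε * s, ?_, ?_⟩
    · rw [pow_add, hpow, ← mul_assoc, hm]; ring
    · rw [hfj, hfg, hgm m (hbound j m hm (by omega))]

theorem number_lemma {X : Type*} (p k : ℕ) (hp : 2 ≤ p) (hk : 1 ≤ k) (ρ d lam : ℤ) (hρ : ρ ≠ 0)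
    (τ : ℕ → ℤ) (hτ : ∀ j, τ (j + 1) = τ j + d * lam ^ j)
    (f g : ℕ → X) (hf : EPf f) (hg : EPf g) :
    NiceSet p {j : ℕ | ∃ m : ℕ, τ j = ρ * (p : ℤ) ^ (m * k) ∧ f j = g m} := by
  have hEP : EPf τ → NiceSet p {j : ℕ | ∃ m : ℕ, τ j = ρ * (p : ℤ) ^ (m * k) ∧ f j = g m} := by
    intro h
    left
    exact (h.pair hf).comp (fun x => ∃ m : ℕ, x.1 = ρ * (p : ℤ) ^ (m * k) ∧ x.2 = g m)
  by_cases hd : d = 0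
  · apply hEP
    exact ⟨0, 1, one_pos, fun n _ => by rw [hτ, hd]; ring⟩
  by_cases h0 : lam = 0
  · apply hEP
    refine ⟨1, 1, one_pos, fun n hn => ?_⟩
    rw [hτ, h0, zero_pow (by omega)]; ring
  by_cases h1 : lam = -1
  · apply hEP
    refine ⟨0, 2, two_pos, fun n hn => ?_⟩
    rw [show n + 2 = n + 1 + 1 by ring, hτ, hτ, h1]; ring
  by_cases h2 : lam = 1
  · have hlin : ∀ j, τ j = τ 0 + d * j := by
      intro j
      induction j with
      | zero => simp
      | succ j ih => rw [hτ, ih, h2]; push_cast; ring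
    rcases lt_or_gt_of_ne hd with h | h
    · have := num_linear p k hp hk (-ρ) (-d) (-τ 0) (neg_ne_zero.mpr hρ) (by omega) f g hf hg
      convert this using 1
      ext j
      simp only [Set.mem_ofPred_eq]
      refine exists_congr fun m => and_congr_left fun _ => ?_
      rw [hlin]
      constructor <;> intro h <;> linarith
    · have := num_linear p k hp hk ρ d (τ 0) hρ h f g hf hg
      convert this using 1
      ext j
      simp only [Set.mem_ofPred_eq]
      refine exists_congr fun m => and_congr_left fun _ => ?_
      rw [hlin]
  have hl : 2 ≤ lam.natAbs := by omega
  have hgeo : ∀ j, (lam - 1) * τ j = (lam - 1) * τ 0 + d * (lam ^ j - 1) := by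
    intro j
    induction j with
    | zero => simp
    | succ j ih => rw [hτ, mul_add, ih]; ring
  have hl1 : lam - 1 ≠ 0 := sub_ne_zero.mpr h2
  have hiff : ∀ j m, τ j = ρ * (p : ℤ) ^ (m * k) ↔
      d * lam ^ j = ((lam - 1) * ρ) * (p : ℤ) ^ (m * k) + (d - (lam - 1) * τ 0) := by
    intro j m
    rw [← mul_right_inj' hl1, hgeo]
    constructor <;> intro h <;> linarith
  have hK : (lam - 1) * ρ ≠ 0 := mul_ne_zero hl1 hρ
  left
  by_cases hB : d - (lam - 1) * τ 0 = 0
  · refine (num_exp p k hp d ((lam - 1) * ρ) lam hd hK hl f g hf hg).congr fun j => ?_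
    simp only [Set.mem_ofPred_eq, hiff, hB, add_zero]
  · refine EPf.of_finite (Set.Finite.subset (exp_eq_finite d ((lam - 1) * ρ) _ lam p hd hK hB hl hp) ?_)
    rintro j ⟨m, hm, -⟩
    exact ⟨m * k, (hiff j m).mp hm⟩

section sml
open Polynomial

theorem prod_roots_dvd (Q : ℤ[X]) (T : Finset ℕ) (h : ∀ t ∈ T, Q.eval (t : ℤ) = 0) :
    (∏ t ∈ T, (X - C (t : ℤ))) ∣ Q := by
  by_cases hQ : Q = 0
  · rw [hQ]; exact dvd_zero _
  have h1 : (T.val.map (fun t : ℕ => (t : ℤ))) ≤ Q.roots := by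
    rw [Multiset.le_iff_subset]
    · intro x hx
      obtain ⟨t, ht, rfl⟩ := Multiset.mem_map.mp hx
      rw [mem_roots hQ]
      exact h t ht
    · exact T.nodup.map Nat.cast_injective
  have h2 := (Multiset.prod_X_sub_C_dvd_iff_le_roots hQ _).mpr h1
  rw [Multiset.map_map] at h2
  exact h2

theorem fact_quot_dvd (q : ℕ) (hq : q.Prime) (hq3 : 3 ≤ q) (n k h : ℕ) (hkn : k ≤ n) (hk : 2 * h ≤ k) :
    q ^ (padicValNat q n.factorial + h) ∣ (n.factorial / k.factorial) * q ^ k := by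
  have : Fact q.Prime := ⟨hq⟩
  have hd := Nat.factorial_dvd_factorial hkn
  obtain ⟨x, hx⟩ := hd
  rw [hx, Nat.mul_div_cancel_left _ (Nat.factorial_pos k)]
  have hx0 : x ≠ 0 := by
    rintro rfl
    exact n.factorial_ne_zero (by simpa using hx)
  rw [padicValNat_dvd_iff_le (mul_ne_zero hx0 (pow_ne_zero _ hq.ne_zero)),
    padicValNat.mul (k.factorial_ne_zero) hx0, padicValNat.mul hx0 (pow_ne_zero _ hq.ne_zero),
    padicValNat.prime_pow]
  have h1 := sub_one_mul_padicValNat_factorial (p := q) k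
  have h2 : 2 * padicValNat q k.factorial ≤ (q - 1) * padicValNat q k.factorial :=
    Nat.mul_le_mul_right _ (by omega)
  omega

theorem hansel (q : ℕ) (hq : q.Prime) (hq3 : 3 ≤ q) (b W : ℕ → ℤ)
    (hW : ∀ j, W j = ∑ k ∈ range (j + 1), (j.choose k : ℤ) * (q : ℤ) ^ k * b k)
    (hinf : {j | W j = 0}.Infinite) (j : ℕ) : W j = 0 := by
  have : Fact q.Prime := ⟨hq⟩
  by_contra hne
  set h := padicValNat q (W j).natAbs + 1 with hh
  obtain ⟨T, hT, hcard⟩ := hinf.exists_subset_card_eq (2 * h)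
  obtain ⟨n, hjn, hTn⟩ : ∃ n, j ≤ n ∧ ∀ t ∈ T, t ≤ n := by
    refine ⟨j + T.sup id, by omega, fun t ht => ?_⟩
    have := Finset.le_sup (f := id) ht
    simp only [id] at this
    omega
  set Q : ℤ[X] := ∑ k ∈ range (n + 1),
    C (((n.factorial / k.factorial : ℕ) : ℤ) * (q : ℤ) ^ k * b k) * descPochhammer ℤ k with hQ
  have hev : ∀ t : ℕ, t ≤ n → Q.eval (t : ℤ) = n.factorial * W t := by
    intro t ht
    have h1 : W t = ∑ k ∈ range (n + 1), (t.choose k : ℤ) * (q : ℤ) ^ k * b k := by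
      rw [hW]
      apply Finset.sum_subset
      · intro x hx; simp only [Finset.mem_range] at *; omega
      · intro x hx hx'
        simp only [Finset.mem_range] at *
        rw [Nat.choose_eq_zero_of_lt (by omega)]; simp
    rw [h1, hQ, eval_finsetSum, Finset.mul_sum]
    refine Finset.sum_congr rfl fun k hk => ?_
    rw [eval_mul, eval_C, descPochhammer_eval_eq_descFactorial, Nat.descFactorial_eq_factorial_mul_choose]
    have hkn : k ≤ n := by simp only [Finset.mem_range] at hk; omega
    have h2 : n.factorial / k.factorial * k.factorial = n.factorial :=
      Nat.div_mul_cancel (Nat.factorial_dvd_factorial hkn)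
    have h3 : (n.factorial : ℤ) = ((n.factorial / k.factorial : ℕ) : ℤ) * (k.factorial : ℤ) := by
      exact_mod_cast h2.symm
    rw [h3, Nat.cast_mul]
    ring
  set s := padicValNat q n.factorial + h with hs
  have hs1 : 1 < q ^ s := Nat.one_lt_pow (by omega) hq.one_lt
  have : Fact (1 < q ^ s) := ⟨hs1⟩
  have : Nontrivial (ZMod (q ^ s)) := ZMod.nontrivial _
  let φ : ℤ →+* ZMod (q ^ s) := Int.castRingHom _
  have hdvd : (∏ t ∈ T, (X - C (φ (t : ℤ)))) ∣ Q.map φ := by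
    have h1 := prod_roots_dvd Q T (fun t ht => by
      rw [hev t (hTn t ht)]
      have : W t = 0 := hT ht
      rw [this, mul_zero])
    have h2 := Polynomial.map_dvd φ h1
    rw [Polynomial.map_prod] at h2
    simpa using h2
  have hmon : (∏ t ∈ T, (X - C (φ (t : ℤ)))).Monic := monic_prod_of_monic _ _ (fun t _ => monic_X_sub_C _)
  have hdeg : (∏ t ∈ T, (X - C (φ (t : ℤ)))).degree = ((2 * h : ℕ) : WithBot ℕ) := by
    rw [degree_eq_natDegree hmon.ne_zero, natDegree_finsetProd_X_sub_C_eq_card, hcard]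
  have hQdeg : (Q.map φ).degree < ((2 * h : ℕ) : WithBot ℕ) := by
    rw [hQ, Polynomial.map_sum]
    refine lt_of_le_of_lt (degree_sum_le _ _) ?_
    rw [Finset.sup_lt_iff (WithBot.bot_lt_coe _)]
    intro k hk
    by_cases hkl : 2 * h ≤ k
    · have hkn : k ≤ n := by simp only [Finset.mem_range] at hk; omega
      have h1 := fact_quot_dvd q hq hq3 n k h hkn hkl
      have h2 : φ (((n.factorial / k.factorial : ℕ) : ℤ) * (q : ℤ) ^ k * b k) = 0 := by
        rw [map_mul]
        have : φ (((n.factorial / k.factorial : ℕ) : ℤ) * (q : ℤ) ^ k) = 0 := by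
          have := (ZMod.natCast_eq_zero_iff _ _).mpr h1
          rw [Nat.cast_mul, Nat.cast_pow] at this
          rw [map_mul, map_pow]
          simp only [φ, Int.coe_castRingHom, Int.cast_natCast]
          exact this
        rw [this, zero_mul]
      rw [Polynomial.map_mul, map_C, h2, C_0, zero_mul, degree_zero]
      exact WithBot.bot_lt_coe _
    · rw [Polynomial.map_mul, map_C]
      refine lt_of_le_of_lt degree_le_natDegree ?_
      have h1 := natDegree_C_mul_le (φ (((n.factorial / k.factorial : ℕ) : ℤ) * (q : ℤ) ^ k * b k))
        ((descPochhammer ℤ k).map φ)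
      have h2 : ((descPochhammer ℤ k).map φ).natDegree ≤ (descPochhammer ℤ k).natDegree :=
        natDegree_map_le
      rw [descPochhammer_natDegree] at h2
      exact Nat.cast_lt.mpr (lt_of_le_of_lt (h1.trans h2) (by omega))
  have hQ0 : Q.map φ = 0 := by
    by_contra hc
    exact hmon.not_dvd_of_degree_lt hc (by rw [hdeg]; exact hQdeg) hdvd
  have h3 : φ (Q.eval (j : ℤ)) = 0 := by
    rw [← Polynomial.eval_map_apply, hQ0, eval_zero]
  rw [hev j hjn] at h3
  have h4 : ((q ^ s : ℕ) : ℤ) ∣ n.factorial * W j := (ZMod.intCast_zmod_eq_zero_iff_dvd _ _).mp h3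
  have h5 : q ^ s ∣ n.factorial * (W j).natAbs := by
    have := Int.natAbs_dvd_natAbs.mpr h4
    simpa [Int.natAbs_mul] using this
  have hne' : (W j).natAbs ≠ 0 := Int.natAbs_ne_zero.mpr hne
  rw [padicValNat_dvd_iff_le (mul_ne_zero n.factorial_ne_zero hne'),
    padicValNat.mul n.factorial_ne_zero hne'] at h5
  omega

/-- the shift operator -/
def shiftE : Module.End ℤ (ℕ → ℤ) where
  toFun w n := w (n + 1)
  map_add' _ _ := rfl
  map_smul' _ _ := rfl

theorem shiftE_pow (e : ℕ) (w : ℕ → ℤ) (n : ℕ) : (shiftE ^ e) w n = w (n + e) := by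
  induction e generalizing n with
  | zero => simp
  | succ e ih =>
    rw [pow_succ', Module.End.mul_apply]
    change (shiftE ^ e) w (n + 1) = _
    rw [ih]; congr 1; ring

theorem exists_pow_decomp (P : ℤ[X]) (hP : P.Monic) (q : ℕ) (hq : q.Prime) (h0 : ¬ (q : ℤ) ∣ P.coeff 0) :
    ∃ (a : ℕ) (U V : ℤ[X]), 0 < a ∧ X ^ a = 1 + C (q : ℤ) * V + P * U := by
  have : Fact q.Prime := ⟨hq⟩
  let φ : ℤ →+* ZMod q := Int.castRingHom _
  have hmon : (P.map φ).Monic := hP.map φ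
  have := hmon.finite_adjoinRoot
  have : Finite (AdjoinRoot (P.map φ)) := Module.finite_of_finite (ZMod q)
  have hc : φ (P.coeff 0) ≠ 0 := by
    intro h
    exact h0 ((ZMod.intCast_zmod_eq_zero_iff_dvd _ _).mp h)
  have hu : IsUnit (AdjoinRoot.mk (P.map φ) X) := by
    have h1 := divX_mul_X_add (P.map φ)
    have h2 := congrArg (AdjoinRoot.mk (P.map φ)) h1
    rw [AdjoinRoot.mk_self, map_add, map_mul, coeff_map] at h2
    have h3 : IsUnit (AdjoinRoot.mk (P.map φ) (C (φ (P.coeff 0)))) :=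
      ((isUnit_iff_ne_zero.mpr hc).map C).map _
    have h4 : (AdjoinRoot.mk (P.map φ)) (P.map φ).divX * (AdjoinRoot.mk (P.map φ)) X =
        -(AdjoinRoot.mk (P.map φ) (C (φ (P.coeff 0)))) := eq_neg_of_add_eq_zero_left h2
    exact isUnit_of_mul_isUnit_right (h4 ▸ h3.neg)
  obtain ⟨u, hu⟩ := hu
  obtain ⟨a, ha, hua⟩ := (isOfFinOrder_of_finite u).exists_pow_eq_one
  have h5 : AdjoinRoot.mk (P.map φ) (X ^ a - 1) = 0 := by
    rw [map_sub, map_pow, ← hu, map_one, ← Units.val_pow_eq_pow_val, hua]; simp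
  obtain ⟨U', hU'⟩ := AdjoinRoot.mk_eq_zero.mp h5
  obtain ⟨U, rfl⟩ := Polynomial.map_surjective φ (ZMod.ringHom_surjective φ) U'
  have h6 : C (q : ℤ) ∣ X ^ a - 1 - P * U := by
    rw [C_dvd_iff_dvd_coeff]
    intro i
    have h7 : (X ^ a - 1 - P * U).map φ = 0 := by
      simp only [Polynomial.map_sub, Polynomial.map_pow, map_X, Polynomial.map_one, Polynomial.map_mul]
      rw [hU', sub_self]
    have h8 := congrArg (fun z => coeff z i) h7
    simp only [coeff_map, coeff_zero] at h8
    exact (ZMod.intCast_zmod_eq_zero_iff_dvd _ _).mp h8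
  obtain ⟨V, hV⟩ := h6
  exact ⟨a, U, V, ha, by rw [← hV]; ring⟩

theorem sml_aux (P : ℤ[X]) (hP : P.Monic) (h0 : P.coeff 0 ≠ 0) (w : ℕ → ℤ) (h : aeval shiftE P w = 0) :
    EPf (fun n => w n = 0) := by
  obtain ⟨q, hqge, hq⟩ := Nat.exists_infinite_primes ((P.coeff 0).natAbs + 3)
  have hnd : ¬ (q : ℤ) ∣ P.coeff 0 := by
    intro hd
    have := Int.natAbs_dvd_natAbs.mpr hd
    have := Nat.le_of_dvd (Int.natAbs_pos.mpr h0) this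
    simp at this
    omega
  obtain ⟨a, U, V, ha, hX⟩ := exists_pow_decomp P hP q hq hnd
  have key : ∀ r j, w (a * j + r) = ∑ k ∈ range (j + 1), (j.choose k : ℤ) * (q : ℤ) ^ k *
      (aeval shiftE (V ^ k) w) r := by
    intro r j
    have h1 : P ∣ X ^ (a * j) - (C (q : ℤ) * V + 1) ^ j := by
      rw [pow_mul]
      refine dvd_trans ?_ (sub_dvd_pow_sub_pow _ _ _)
      exact ⟨U, by rw [hX]; ring⟩
    obtain ⟨Y, hY⟩ := h1
    have h2 : (X : ℤ[X]) ^ (a * j) = (C (q : ℤ) * V + 1) ^ j + Y * P := by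
      rw [mul_comm Y, ← hY]; ring
    have h3 : aeval shiftE ((X : ℤ[X]) ^ (a * j)) w = aeval shiftE ((C (q : ℤ) * V + 1) ^ j) w := by
      rw [h2, map_add, map_mul, LinearMap.add_apply, Module.End.mul_apply, h, map_zero, add_zero]
    have h4 := congrFun h3 r
    rw [map_pow, aeval_X, shiftE_pow, add_comm] at h4
    rw [h4, add_pow, map_sum, LinearMap.sum_apply, Finset.sum_apply]
    refine Finset.sum_congr rfl fun k _ => ?_
    have h5 : (C (q : ℤ) * V) ^ k * 1 ^ (j - k) * ((j.choose k : ℕ) : ℤ[X]) =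
        C ((j.choose k : ℤ) * (q : ℤ) ^ k) * V ^ k := by
      rw [mul_pow, C_mul, C_pow, one_pow]
      simp
      ring
    rw [h5, ← smul_eq_C_mul, map_smul, LinearMap.smul_apply, Pi.smul_apply, smul_eq_mul]
  have hfin : ∀ r, ∃ N, ∀ j, N ≤ j → ((w (a * (j + 1) + r) = 0) = (w (a * j + r) = 0)) := by
    intro r
    by_cases hinf : {j | w (a * j + r) = 0}.Infinite
    · have := hansel q hq (by omega) _ (fun j => w (a * j + r)) (key r) hinf
      exact ⟨0, fun j _ => by simp [this]⟩
    · rw [Set.not_infinite] at hinf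
      obtain ⟨B, hB⟩ := hinf.bddAbove
      refine ⟨B + 1, fun j hj => ?_⟩
      apply propext
      constructor
      · intro hz
        have : j + 1 ≤ B := hB hz
        omega
      · intro hz
        have : j ≤ B := hB hz
        omega
  choose N hN using hfin
  refine ⟨a * ((range a).sup N), a, ha, fun n hn => ?_⟩
  have h1 : n / a ≥ (range a).sup N := by
    rw [ge_iff_le, Nat.le_div_iff_mul_le ha, mul_comm]; exact hn
  have h2 := hN (n % a) (n / a) (le_trans (Finset.le_sup (f := N)
    (Finset.mem_range.mpr (Nat.mod_lt n ha))) h1)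
  have h3 := Nat.div_add_mod n a
  rw [h3, mul_add, mul_one, add_right_comm, h3] at h2
  exact h2

theorem sml (P : ℤ[X]) (hP : P.Monic) (w : ℕ → ℤ) (h : aeval shiftE P w = 0) :
    EPf (fun n => w n = 0) := by
  obtain ⟨P1, h1, h2⟩ := exists_eq_pow_rootMultiplicity_mul_and_not_dvd P hP.ne_zero 0
  set e := rootMultiplicity 0 P
  rw [C_0, sub_zero] at h1 h2
  have hP1 : P1.Monic := (monic_X_pow e).of_mul_monic_left (h1 ▸ hP)
  have h3 : P1.coeff 0 ≠ 0 := by rwa [Ne, ← X_dvd_iff]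
  rw [h1, mul_comm, map_mul, Module.End.mul_apply, map_pow, aeval_X] at h
  obtain ⟨N, a, ha, H⟩ := sml_aux P1 hP1 h3 _ h
  refine ⟨N + e, a, ha, fun n hn => ?_⟩
  obtain ⟨i, rfl⟩ := Nat.exists_eq_add_of_le' (le_trans (Nat.le_add_left e N) hn)
  have := H i (by omega)
  simp only [shiftE_pow] at this
  rw [add_right_comm]
  exact this

end sml

section grp

theorem exists_coords (G : Type*) [AddCommGroup G] [AddGroup.FG G] :
    ∃ (r : ℕ) (π : Fin r → (G →+ ℤ)) (e : ℕ), e ≠ 0 ∧ ∀ g, (∀ i, π i g = 0) → e • g = 0 := by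
  obtain ⟨r, ι, _, p, hp, e, ⟨φ⟩⟩ := AddCommGroup.equiv_free_prod_directSum_zmod G
  refine ⟨r, fun i => ((Finsupp.applyAddHom i).comp (AddMonoidHom.fst _ _)).comp φ.toAddMonoidHom,
    ∏ i, p i ^ e i, ?_, ?_⟩
  · exact Finset.prod_ne_zero_iff.mpr fun i _ => pow_ne_zero _ (hp i).ne_zero
  · intro g hg
    apply φ.injective
    rw [map_nsmul, map_zero]
    ext i
    · have : (φ g).1 i = 0 := hg i
      simp [this]
    · have hd : p i ^ e i ∣ ∏ i, p i ^ e i := Finset.dvd_prod_of_mem _ (Finset.mem_univ i)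
      have : ((∏ i, p i ^ e i) • (φ g).2) i = (∏ i, p i ^ e i) • ((φ g).2 i) := rfl
      rw [Prod.smul_snd, this, nsmul_eq_mul, (ZMod.natCast_eq_zero_iff _ _).mpr hd, zero_mul]
      rfl

theorem hit_EP {X : Type*} (F : X → X) (u : ℕ → X) (hu : ∀ n, u (n + 1) = F (u n)) (g : X) :
    EPf (fun n => u n = g) := by
  by_cases hsub : Set.Subsingleton {n | u n = g}
  · exact EPf.of_finite hsub.finite
  · simp only [Set.Subsingleton, not_forall] at hsub
    obtain ⟨m, hm, n, hn, hne⟩ := hsub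
    have hm' : u m = g := hm
    have hn' : u n = g := hn
    clear hm hn
    wlog hlt : m < n generalizing m n
    · exact this n m (Ne.symm hne) hn' hm' (by omega)
    have : EPf u := by
      refine ⟨m, n - m, by omega, fun j hj => ?_⟩
      induction j, hj using Nat.le_induction with
      | base => rw [show m + (n - m) = n by omega, hm', hn']
      | succ j _ ih => rw [show j + 1 + (n - m) = j + (n - m) + 1 by omega, hu, ih, hu]
    exact this.comp (fun x => x = g)

theorem case_finite {X : Type*} (p : ℕ) (F : X → X) (u : ℕ → X) (hu : ∀ n, u (n + 1) = F (u n))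
    (c : ℕ → X) (hc : EPf c) : GoodSet p {n | ∃ m, u n = c m} := by
  obtain ⟨N, a, ha, H⟩ := hc
  have := GoodSet.range_union (p := p) (N + a) (T := fun m => {n | u n = c m})
    (fun i _ => GoodSet.of_EP (hit_EP F u hu (c i)))
  convert this using 1
  ext n
  simp only [Set.mem_ofPred_eq]
  constructor
  · rintro ⟨m, hm⟩
    by_cases hmN : m < N
    · exact ⟨m, by omega, hm⟩
    · have h1 := Nat.mod_add_div (m - N) a
      have h2 := Nat.mod_lt (m - N) ha
      have h3 := EPf.mul_aux H ((m - N) / a) (N + (m - N) % a) (by omega)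
      rw [show N + (m - N) % a + a * ((m - N) / a) = m by omega] at h3
      exact ⟨N + (m - N) % a, by omega, by rw [hm, h3]⟩
  · rintro ⟨i, -, h⟩
    exact ⟨i, h⟩

open Polynomial in
theorem rec_EP {G : Type*} [AddCommGroup G] (ℓ : ℕ) (c : ℕ → ℤ) (Φ₀ : G →+ G)
    (hrec : ∀ x : G, (⇑Φ₀)^[ℓ] x + ∑ i ∈ Finset.range ℓ, c i • (⇑Φ₀)^[i] x = 0)
    (y : G) (u : ℕ → G) (hu : ∀ n, u (n + 1) = y + Φ₀ (u n)) (σ : G →+ ℤ) (b : ℤ) :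
    EPf (fun n => σ (u n) - b = 0) := by
  set P : ℤ[X] := X ^ ℓ + ∑ i ∈ Finset.range ℓ, C (c i) * X ^ i with hP
  have hPm : P.Monic := by
    apply monic_X_pow_add
    refine lt_of_le_of_lt (degree_sum_le _ _) ?_
    rw [Finset.sup_lt_iff (WithBot.bot_lt_coe _)]
    intro i hi
    refine lt_of_le_of_lt (degree_C_mul_X_pow_le _ _) ?_
    exact Nat.cast_lt.mpr (Finset.mem_range.mp hi)
  refine sml (P * (X - C 1)) (hPm.mul (monic_X_sub_C 1)) _ ?_
  have hδ : ∀ n, u (n + 1) - u n = (⇑Φ₀)^[n] (u 1 - u 0) := by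
    intro n
    induction n with
    | zero => simp
    | succ n ih =>
      have h1 := hu (n + 1)
      have h2 := hu n
      rw [Function.iterate_succ_apply', ← ih, map_sub, eq_sub_of_add_eq' h1.symm,
        eq_sub_of_add_eq' h2.symm]
      abel
  have h1 : aeval shiftE (X - C 1 : ℤ[X]) (fun n => σ (u n) - b) =
      fun n => σ ((⇑Φ₀)^[n] (u 1 - u 0)) := by
    ext n
    simp only [map_sub, aeval_X, map_one, LinearMap.sub_apply, Pi.sub_apply, Module.End.one_apply]
    change (σ (u (n + 1)) - b) - (σ (u n) - b) = _
    rw [← hδ, map_sub]; ring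
  rw [map_mul, Module.End.mul_apply, h1]
  ext n
  rw [hP]
  simp only [map_add, map_sum, map_mul, map_pow, aeval_X, LinearMap.add_apply, Pi.add_apply,
    LinearMap.sum_apply, Finset.sum_apply, Module.End.mul_apply, aeval_C, shiftE_pow]
  have h2 := congrArg σ (hrec ((⇑Φ₀)^[n] (u 1 - u 0)))
  rw [map_add, map_sum, map_zero] at h2
  rw [Pi.zero_apply, ← h2]
  congr 1
  · rw [← Function.iterate_add_apply, add_comm]
  · refine Finset.sum_congr rfl fun i _ => ?_
    rw [map_zsmul, ← Function.iterate_add_apply]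
    simp [shiftE_pow, add_comm]

theorem int_ratio (ρ κ : ℤ) (hρ : ρ ≠ 0) (d : ℕ → ℤ) (h : ∀ j, ρ * d (j + 1) = κ * d j) :
    ∃ lam : ℤ, ∀ j, d j = d 0 * lam ^ j := by
  by_cases h0 : d 0 = 0
  · refine ⟨0, fun j => ?_⟩
    rw [h0, zero_mul]
    induction j with
    | zero => exact h0
    | succ j ih =>
      have := h j
      rw [ih, mul_zero] at this
      exact (mul_eq_zero.mp this).resolve_left hρ
  have hg : 0 < ρ.gcd κ := Int.gcd_pos_of_ne_zero_left _ hρ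
  obtain ⟨ρ', κ', hcop, e1, e2⟩ := Int.exists_gcd_one hg
  have hg0 : ((ρ.gcd κ : ℕ) : ℤ) ≠ 0 := by exact_mod_cast hg.ne'
  have h' : ∀ j, ρ' * d (j + 1) = κ' * d j := by
    intro j
    have := h j
    apply mul_left_cancel₀ hg0
    linear_combination this - d (j + 1) * e1 + d j * e2
  have hpow : ∀ j, ρ' ^ j * d j = κ' ^ j * d 0 := by
    intro j
    induction j with
    | zero => simp
    | succ j ih =>
      calc ρ' ^ (j + 1) * d (j + 1) = ρ' ^ j * (ρ' * d (j + 1)) := by ring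
        _ = κ' * (ρ' ^ j * d j) := by rw [h']; ring
        _ = κ' ^ (j + 1) * d 0 := by rw [ih]; ring
  have hcop' : IsCoprime ρ' κ' := Int.isCoprime_iff_gcd_eq_one.mpr hcop
  have hdiv : ∀ j, ρ' ^ j ∣ d 0 := by
    intro j
    have : IsCoprime (ρ' ^ j) (κ' ^ j) := hcop'.pow
    exact this.dvd_of_dvd_mul_left ⟨d j, (hpow j).symm⟩
  have hρ'0 : ρ' ≠ 0 := by
    rintro rfl
    exact hρ (by rw [e1, zero_mul])
  have hunit : ρ'.natAbs = 1 := by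
    by_contra hne
    have h2 : 1 < ρ'.natAbs := by
      have := Int.natAbs_pos.mpr hρ'0
      omega
    have h3 := Int.natAbs_dvd_natAbs.mpr (hdiv (d 0).natAbs)
    rw [Int.natAbs_pow] at h3
    have h4 := Nat.le_of_dvd (Int.natAbs_pos.mpr h0) h3
    have h5 := Nat.lt_pow_self (n := (d 0).natAbs) h2
    omega
  have hsq : ρ' * ρ' = 1 := by
    rcases Int.natAbs_eq ρ' with h | h <;> rw [h, hunit] <;> norm_num
  refine ⟨ρ' * κ', fun j => ?_⟩
  have h6 : ρ' ^ j * ρ' ^ j = 1 := by rw [← mul_pow, hsq, one_pow]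
  rw [mul_pow]
  linear_combination (-(d j)) * h6 + ρ' ^ j * hpow j

theorem main_good {G : Type*} [AddCommGroup G] [AddGroup.FG G]
    (ℓ : ℕ) (c : ℕ → ℤ) (Φ₀ : G →+ G)
    (hrec : ∀ x : G, (⇑Φ₀)^[ℓ] x + ∑ i ∈ Finset.range ℓ, c i • (⇑Φ₀)^[i] x = 0)
    (y : G) (u : ℕ → G) (hu : ∀ n, u (n + 1) = y + Φ₀ (u n))
    (p : ℕ) (hp : 2 ≤ p) (k : ℕ) (R₁ R₂ : G) :
    GoodSet p {n : ℕ | ∃ m : ℕ, u n = R₁ + ((p : ℤ) ^ (m * k)) • R₂} := by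
  obtain ⟨r, π, e, he, hπ⟩ := exists_coords G
  by_cases hk : k = 0
  · subst hk
    refine case_finite p (fun x => y + Φ₀ x) u hu _ ?_
    exact (EPf.const (R₁ + R₂)).congr fun n => by simp
  by_cases hR : ∀ i, π i R₂ = 0
  · refine case_finite p (fun x => y + Φ₀ x) u hu _ ?_
    have hR2 := hπ R₂ hR
    obtain ⟨N, a, ha, H⟩ := EPf.pow_mod e he ((p : ℤ) ^ k)
    refine ⟨N, a, ha, fun n hn => ?_⟩
    have h1 := H n hn
    have h2 : (e : ℤ) ∣ ((p : ℤ) ^ k) ^ (n + a) - ((p : ℤ) ^ k) ^ n := by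
      rw [← ZMod.intCast_zmod_eq_zero_iff_dvd, Int.cast_sub]
      exact sub_eq_zero.mpr h1
    obtain ⟨z, hz⟩ := h2
    have h3 : (p : ℤ) ^ ((n + a) * k) = (p : ℤ) ^ (n * k) + z * e := by
      rw [mul_comm (n + a) k, mul_comm n k, pow_mul, pow_mul]
      linear_combination hz
    simp only [h3]
    rw [add_smul, mul_smul, natCast_zsmul, hR2, smul_zero, add_zero]
  push Not at hR
  obtain ⟨i0, hρ⟩ := hR
  set ρ := π i0 R₂ with hρdef
  have hker : ∀ (n : ℕ) (g : G), (∀ i, π i g = 0) → ∀ i, π i ((⇑Φ₀)^[n] g) = 0 := by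
    intro n g hg i
    have h1 : e • ((⇑Φ₀)^[n] g) = 0 := by
      have h2 : ∀ n, (⇑Φ₀)^[n] (e • g) = e • (⇑Φ₀)^[n] g := by
        intro n
        induction n with
        | zero => rfl
        | succ n ih => rw [Function.iterate_succ_apply', ih, map_nsmul, Function.iterate_succ_apply']
      rw [← h2, hπ g hg]
      exact iterate_map_zero Φ₀ n
    have h3 := congrArg (π i) h1
    rw [map_nsmul, map_zero, smul_eq_zero] at h3
    exact h3.resolve_left he
  -- finite quotient
  let H : AddSubgroup G := (nsmulAddMonoidHom (α := G) e).range
  have hHfin : H.FiniteIndex := AddSubgroup.finiteIndex_range_nsmulAddMonoidHom_of_fg G he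
  have hfinq : Finite (G ⧸ H) := AddSubgroup.finiteIndex_iff_finite_quotient.mp hHfin
  have hHmap : H ≤ AddSubgroup.comap Φ₀ H := by
    rintro x ⟨z, rfl⟩
    exact ⟨Φ₀ z, by simp⟩
  have hcrit : ∀ x z : G, x = z ↔ (∀ i, π i x = π i z) ∧ (x : G ⧸ H) = (z : G ⧸ H) := by
    intro x z
    constructor
    · rintro rfl; exact ⟨fun _ => rfl, rfl⟩
    · rintro ⟨h1, h2⟩
      rw [QuotientAddGroup.eq_iff_sub_mem] at h2
      obtain ⟨t, ht⟩ := h2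
      have ht' : e • t = x - z := ht
      have h3 : ∀ i, π i t = 0 := by
        intro i
        have h4 := congrArg (π i) ht'
        rw [map_nsmul, map_sub, h1 i, sub_self, smul_eq_zero] at h4
        exact h4.resolve_left he
      rw [hπ t h3] at ht'
      exact (sub_eq_zero.mp ht'.symm)
  have hf : EPf (fun n => ((u n : G) : G ⧸ H)) := by
    refine EPf.of_iter (fun x => (y : G ⧸ H) + QuotientAddGroup.map H H Φ₀ hHmap x) fun n => ?_
    rw [hu]
    rfl
  have hg : EPf (fun m => ((R₁ + ((p : ℤ) ^ (m * k)) • R₂ : G) : G ⧸ H)) := by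
    have h1 : EPf (fun m => ((((p : ℤ) ^ (m * k)) • R₂ : G) : G ⧸ H)) := by
      refine EPf.of_iter (fun x => ((p : ℤ) ^ k) • x) fun n => ?_
      rw [add_mul, one_mul, pow_add, mul_comm, mul_smul]
      rfl
    exact h1.comp (fun x => (R₁ : G ⧸ H) + x)
  -- the line condition
  let σ : Fin r → (G →+ ℤ) := fun i => ρ • π i - (π i R₂) • π i0
  have hσ : ∀ i g, σ i g = ρ * π i g - π i R₂ * π i0 g := fun i g => by simp [σ]
  have hZ : EPf (fun n => ∀ i, σ i (u n) - σ i R₁ = 0) :=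
    EPf.forall_fin fun i => rec_EP ℓ c Φ₀ hrec y u hu (σ i) (σ i R₁)
  obtain ⟨N, a, ha, HZ⟩ := hZ
  have hSZ : ∀ n m, u n = R₁ + ((p : ℤ) ^ (m * k)) • R₂ → ∀ i, σ i (u n) - σ i R₁ = 0 := by
    intro n m h i
    rw [h, map_add, map_zsmul, hσ i R₂]
    simp only [smul_eq_mul]
    rw [← hρdef]; ring
  set S := {n : ℕ | ∃ m : ℕ, u n = R₁ + ((p : ℤ) ^ (m * k)) • R₂} with hS
  have hδ : ∀ n s, u (n + 1 + s) - u (n + s) = (⇑Φ₀)^[s] (u (n + 1) - u n) := by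
    intro n s
    induction s with
    | zero => simp
    | succ s ih =>
      rw [Function.iterate_succ_apply', ← ih, map_sub, ← add_assoc, ← add_assoc, hu (n + 1 + s), hu (n + s)]
      abel
  have hδ2 : ∀ n t s, u (n + t + s) - u (n + s) = (⇑Φ₀)^[s] (u (n + t) - u n) := by
    intro n t s
    induction t with
    | zero => simp
    | succ t ih =>
      have h1 := hδ (n + t) s
      have h2 : u (n + (t + 1)) - u n = (u (n + t + 1) - u (n + t)) + (u (n + t) - u n) := by
        rw [← add_assoc]; abel
      rw [h2, iterate_map_add, ← h1, ← ih, ← add_assoc]; abel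
  have hclass : ∀ b, NiceSet p {j | a * j + b ∈ S} ∨ ¬ N ≤ b := by
    intro b
    by_cases hNb : N ≤ b
    swap
    · exact Or.inr hNb
    left
    by_cases hb : ∀ i, σ i (u b) - σ i R₁ = 0
    swap
    · left
      have : {j | a * j + b ∈ S} = ∅ := by
        ext j
        simp only [Set.mem_empty_iff_false, iff_false]
        rintro ⟨m, hm⟩
        apply hb
        have h1 := EPf.mul_aux (f := fun n => ∀ i, σ i (u n) - σ i R₁ = 0) HZ j b hNb
        have h2 := hSZ _ m hm
        rw [add_comm] at h2
        exact h1 ▸ h2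
      rw [this]
      exact EPf.of_finite Set.finite_empty
    have hline : ∀ j i, ρ * π i (u (a * j + b) - R₁) = π i R₂ * π i0 (u (a * j + b) - R₁) := by
      intro j i
      have h1 := EPf.mul_aux (f := fun n => ∀ i, σ i (u n) - σ i R₁ = 0) HZ j b hNb
      have h2 : ∀ i, σ i (u (b + a * j)) - σ i R₁ = 0 := by
        rw [h1]; exact hb
      have h3 := h2 i
      rw [← map_sub, hσ, add_comm] at h3
      linarith
    let d : ℕ → ℤ := fun j => π i0 (u (a * (j + 1) + b) - u (a * j + b))
    have hd : ∀ j, ρ * d (j + 1) = π i0 ((⇑Φ₀)^[a] R₂) * d j := by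
      intro j
      set w := u (a * (j + 1) + b) - u (a * j + b) with hw
      have h1 : u (a * (j + 1 + 1) + b) - u (a * (j + 1) + b) = (⇑Φ₀)^[a] w := by
        have := hδ2 (a * j + b) a a
        rw [hw, show a * (j + 1 + 1) + b = a * j + b + a + a by ring,
          show a * (j + 1) + b = a * j + b + a by ring, this]
      have h2 : ∀ i, π i (ρ • w - d j • R₂) = 0 := by
        intro i
        have h3 := hline (j + 1) i
        have h4 := hline j i
        have h5 : w = (u (a * (j + 1) + b) - R₁) - (u (a * j + b) - R₁) := by rw [hw]; abel
        have h6 : d j = π i0 w := rfl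
        rw [map_sub, map_zsmul, map_zsmul, smul_eq_mul, smul_eq_mul, h6, h5, map_sub, map_sub (π i0)]
        linear_combination h3 - h4
      have h7 := hker a _ h2 i0
      rw [iterate_map_sub, iterate_map_zsmul, iterate_map_zsmul, map_sub, map_zsmul, map_zsmul,
        smul_eq_mul, smul_eq_mul, ← h1] at h7
      change ρ * π i0 (u (a * (j + 1 + 1) + b) - u (a * (j + 1) + b)) = _
      linarith
    obtain ⟨lam, hlam⟩ := int_ratio ρ _ hρ d hd
    have hfr : EPf (fun j => ((u (a * j + b) : G) : G ⧸ H)) := by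
      obtain ⟨N', a', ha', Hf⟩ := hf
      refine ⟨N', a', ha', fun j hj => ?_⟩
      have h1 : j ≤ a * j := Nat.le_mul_of_pos_left j ha
      have := EPf.mul_aux (f := fun n => ((u n : G) : G ⧸ H)) Hf a (a * j + b) (by omega)
      rw [show a * j + b + a' * a = a * (j + a') + b by ring] at this
      exact this
    have := number_lemma p k hp (by omega) ρ (d 0) lam hρ (fun j => π i0 (u (a * j + b) - R₁))
      (fun j => by
        rw [← hlam j]
        simp only [d, map_sub]; ring) _ _ hfr hg
    convert this using 1
    ext j
    simp only [Set.mem_ofPred_eq, hS]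
    refine exists_congr fun m => ?_
    rw [hcrit]
    refine and_congr_left fun _ => ?_
    constructor
    · intro h
      rw [map_sub, h i0, map_add, map_zsmul, smul_eq_mul, hρdef]; ring
    · intro h i
      have h1 := hline j i
      rw [h] at h1
      have h2 : π i (u (a * j + b) - R₁) = π i R₂ * (p : ℤ) ^ (m * k) := by
        apply mul_left_cancel₀ hρ
        rw [h1]; ring
      rw [map_sub] at h2
      rw [map_add, map_zsmul, smul_eq_mul]
      linarith
  classical
  have hdecomp : S = {n | ∃ i < N, n ∈ (if i ∈ S then ({i} : Set ℕ) else ∅)} ∪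
      {n | ∃ t < a, n ∈ {n | ∃ j ∈ {j | a * j + (N + t) ∈ S}, n = a * j + (N + t)}} := by
    ext n
    simp only [Set.mem_union, Set.mem_ofPred_eq]
    constructor
    · intro hn
      by_cases hnN : n < N
      · exact Or.inl ⟨n, hnN, by rw [if_pos hn]; rfl⟩
      · right
        have h1 := Nat.mod_add_div (n - N) a
        refine ⟨(n - N) % a, Nat.mod_lt _ ha, (n - N) / a, ?_, by omega⟩
        rw [show a * ((n - N) / a) + (N + (n - N) % a) = n by omega]
        exact hn
    · rintro (⟨i, hi, hn⟩ | ⟨t, -, j, hj, rfl⟩)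
      · split_ifs at hn with h
        · have : n = i := hn
          rwa [this]
        · exact absurd hn (by simp)
      · exact hj
  rw [hdecomp]
  refine (GoodSet.range_union N fun i _ => ?_).union (GoodSet.range_union a fun t _ => ?_)
  · split_ifs
    · exact GoodSet.of_EP (EPf.of_finite (Set.finite_singleton i))
    · exact GoodSet.empty p
  · exact ((hclass (N + t)).resolve_right (by simp)).image_good a (N + t)

end grp

end helpers

end Stmt16Aux

/-- Theorem `combinatorial theorem` part (B): with `G`, `Φ₀`, `Φ` as
in part (A), `p` prime, `k ∈ ℕ₀`, `R₁, R₂ ∈ G` and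
`C = {R₁ + p^{nk}·R₂ : n ∈ ℕ₀}`, the set `S = {n : Φ^n(α) ∈ C}` is a finite union
of `p`-arithmetic sequences together with a finite union of arithmetic
progressions. -/
theorem stmt16 {G : Type*} [AddCommGroup G] [AddGroup.FG G]
    (ℓ : ℕ) (hℓ : 1 ≤ ℓ) (c : ℕ → ℤ) (Φ₀ : G →+ G)
    (hrec : ∀ x : G, (⇑Φ₀)^[ℓ] x + ∑ i ∈ Finset.range ℓ, c i • (⇑Φ₀)^[i] x = 0)
    (y α : G) (Φ : G → G) (hΦ : ∀ x, Φ x = y + Φ₀ x)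
    (p : ℕ) (hp : p.Prime) (k : ℕ) (R₁ R₂ : G)
    (C : Set G) (hC : C = {g : G | ∃ n : ℕ, g = R₁ + ((p : ℤ) ^ (n * k)) • R₂}) :
    ∃ (M : ℕ) (f : Fin M → Set ℕ),
      (∀ i, IsAPNat (f i) ∨ IsPArithSeqNat p (f i)) ∧
      {n : ℕ | Φ^[n] α ∈ C} = ⋃ i, f i := by
  have hmain := Stmt16Aux.main_good ℓ c Φ₀ hrec y (fun n => Φ^[n] α)
    (fun n => by simp only [Function.iterate_succ_apply', hΦ]) p hp.two_le k R₁ R₂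
  obtain ⟨M, f, hf, hS⟩ := hmain
  refine ⟨M, f, hf, ?_⟩
  rw [← hS, hC]
  rfl
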